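/- Let p > 2 be a prime and k the algebraic closure of F_p. Let F_1,…,F_m ∈ k[t][x] with deg_x F_i = r_i > 0 be pairwise non-associate, irreducible, monic in x, and separable over k(t) (i.e. F_i ∉ k[t][x^p]). Let n ≥ 3 be a natural number with n ≥ sl F_i for 1 ≤ i ≤ m. Let a_0,…,a_n be algebraically independent variables, f♯ = Σ_{j=0}^n a_j t^j, and N_i = deg_t F_i(t, f♯) = r_i n. Let L be the splitting field of ∏_{i=1}^m F_i(t, f♯) over k(a_0,…,a_n) and G = Gal(L/k(a_0,…,a_n)), viewed as a subgroup of S_{N_1}×…×S_{N_m} via its action on the roots of the polynomials F_i(t, f♯). Then G is the full product S_{N_1}×…×S_{N_m}. -/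

import Mathlib

open Polynomial

/-- The slope of `P(t,x) = Σ_{j=0}^r c_j(t) x^j ∈ K[t][x]` monic in `x` (with `x` the
outer variable): `sl P = max_{1 ≤ j ≤ r} deg c_{r-j}(t) / j`, where `deg 0 = ⊥`. -/
noncomputable def slopeX {K : Type} [Field K] (P : Polynomial (Polynomial K)) : WithBot ℚ :=
  (Finset.Icc 1 P.natDegree).sup fun j =>
    ((P.coeff (P.natDegree - j)).degree).map fun d : ℕ => (d : ℚ) / (j : ℚ)

/-- The generic polynomial `f♯ = Σ_{j=0}^n a_j t^j`. -/
noncomputable def fsharp (K : Type) [CommRing K] (n : ℕ) :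
    Polynomial (MvPolynomial (Fin (n + 1)) K) :=
  ∑ j : Fin (n + 1), Polynomial.C (MvPolynomial.X j) * Polynomial.X ^ (j : ℕ)

/-- For `F ∈ K[t][x]` (with `x` the outer variable), the substitution
`F(t, f♯) ∈ K[a_0,…,a_n][t]`. -/
noncomputable def substF {K : Type} [CommRing K] (n : ℕ)
    (F : Polynomial (Polynomial K)) :
    Polynomial (MvPolynomial (Fin (n + 1)) K) :=
  Polynomial.eval (fsharp K n) (F.map (Polynomial.mapRingHom MvPolynomial.C))

universe u


section Bivariate

/-- Evaluation of `F(t,x) ∈ k[t][x]` at a pair `(τ, ξ)`. -/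
noncomputable def ev2 {k S : Type*} [CommRing k] [CommRing S] [Algebra k S]
    (F : k[X][X]) (τ ξ : S) : S :=
  eval₂ ((aeval τ : k[X] →ₐ[k] S) : k[X] →+* S) ξ F

variable {k S S' : Type*} [CommRing k] [CommRing S] [Algebra k S] [CommRing S'] [Algebra k S']

theorem map_ev2 (φ : S →ₐ[k] S') (F : k[X][X]) (τ ξ : S) :
    φ (ev2 F τ ξ) = ev2 F (φ τ) (φ ξ) := by
  have h := Polynomial.hom_eval₂ F ((aeval τ : k[X] →ₐ[k] S) : k[X] →+* S) (φ : S →+* S') ξ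
  rw [RingHom.coe_coe] at h
  rw [ev2, ev2, h]
  congr 1
  apply Polynomial.ringHom_ext <;> simp

theorem ev2_mul (F G : k[X][X]) (τ ξ : S) : ev2 (F * G) τ ξ = ev2 F τ ξ * ev2 G τ ξ := by
  simp [ev2, eval₂_mul]

theorem ev2_prod {ι : Type*} (s : Finset ι) (F : ι → k[X][X]) (τ ξ : S) :
    ev2 (∏ i ∈ s, F i) τ ξ = ∏ i ∈ s, ev2 (F i) τ ξ := by
  simp [ev2, eval₂_finsetProd]

theorem ev2_eq_eval (F : k[X][X]) (τ ξ : S) :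
    ev2 F τ ξ = (F.map ((aeval τ : k[X] →ₐ[k] S) : k[X] →+* S)).eval ξ := by
  rw [ev2, eval₂_eq_eval_map]

theorem eval_ev2 (F : k[X][X]) (f : S[X]) (τ : S) :
    (ev2 F X f).eval τ = ev2 F τ (f.eval τ) := by
  have := map_ev2 ((aeval τ : S[X] →ₐ[S] S).restrictScalars k) F X f
  simpa [coe_aeval_eq_eval] using this

theorem mapPoly_ev2 (φ : S →ₐ[k] S') (F : k[X][X]) (f : S[X]) :
    (ev2 F X f).map (φ : S →+* S') = ev2 F X (f.map (φ : S →+* S')) := by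
  have := map_ev2 (mapAlgHom φ) F X f
  simpa using this

/-- Taylor expansion in the second variable. -/
theorem ev2_add (F : k[X][X]) (τ ξ η : S) :
    ∃ c : S, ev2 F τ (ξ + η) = ev2 F τ ξ + ev2 (derivative F) τ ξ * η + c * η ^ 2 := by
  obtain ⟨c, hc⟩ := binomExpansion (F.map ((aeval τ : k[X] →ₐ[k] S) : k[X] →+* S)) ξ η
  refine ⟨c, ?_⟩
  rw [ev2_eq_eval, ev2_eq_eval, ev2_eq_eval, ← derivative_map, hc]

theorem derivative_ev2 (F : k[X][X]) (f : S[X]) (τ : S) :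
    (derivative (ev2 F X f)).eval τ =
      (derivative (ev2 F X (C (f.eval τ)))).eval τ
        + ev2 (derivative F) τ (f.eval τ) * (derivative f).eval τ := by
  obtain ⟨c, hc⟩ := ev2_add F X (C (f.eval τ)) (f - C (f.eval τ))
  rw [add_sub_cancel] at hc
  rw [hc]
  simp [eval_ev2, pow_two]

end Bivariate

section Trdeg

variable {E Ω : Type*} [Field E] [Field Ω] [Algebra E Ω]

/-- Elements algebraic over `E(c)`. -/
noncomputable def algOver (E : Type*) {Ω : Type*} [Field E] [Field Ω] [Algebra E Ω] (c : Ω) :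
    IntermediateField E Ω :=
  (algebraicClosure (IntermediateField.adjoin E {c}) Ω).restrictScalars E

theorem mem_algOver {c z : Ω} :
    z ∈ algOver E c ↔ IsAlgebraic (IntermediateField.adjoin E {c}) z := by
  rw [algOver, IntermediateField.mem_restrictScalars, mem_algebraicClosure_iff]

theorem self_mem_algOver (c : Ω) : c ∈ algOver E c := by
  rw [mem_algOver]
  exact isAlgebraic_algebraMap
    (⟨c, IntermediateField.mem_adjoin_simple_self E c⟩ : IntermediateField.adjoin E {c})

theorem mem_algOver_of_isAlgebraic {c z : Ω} (h : IsAlgebraic E z) : z ∈ algOver E c := by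
  rw [mem_algOver]
  exact h.tower_top _

theorem mem_algOver_trans {c z : Ω} (h : IsAlgebraic (algOver E c) z) : z ∈ algOver E c := by
  have : IsAlgebraic (algebraicClosure (IntermediateField.adjoin E {c}) Ω) z := h
  rw [mem_algOver]
  exact IsAlgebraic.restrictScalars _ this

open IntermediateField.algebraAdjoinAdjoin in
theorem not_both_mem_algOver {b : Fin 2 → Ω} (hb : AlgebraicIndependent E b) (c : Ω) :
    ¬ (b 0 ∈ algOver E c ∧ b 1 ∈ algOver E c) := by
  rintro ⟨h0, h1⟩
  have key : ∀ x, x ∈ algOver E c → x ∈ (AlgebraicIndependent.matroid E Ω).closure {c} := by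
    intro x hx
    rw [AlgebraicIndependent.matroid_closure_eq]
    rw [mem_algOver] at hx
    exact (IsFractionRing.isAlgebraic_iff (Algebra.adjoin E {c})
      (IntermediateField.adjoin E {c}) Ω).2 hx
  have hne : b 0 ≠ b 1 := fun h => by simpa using hb.injective h
  have hind : (AlgebraicIndependent.matroid E Ω).Indep {b 0, b 1} := by
    rw [AlgebraicIndependent.matroid_indep_iff]
    have h := hb.coe_range
    have h' : Set.range b = {b 0, b 1} := by
      ext x; simp [Fin.exists_fin_two, eq_comm]
    rw [h'] at h
    exact h
  have h2 := hind.eRk_eq_encard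
  have h3 : (AlgebraicIndependent.matroid E Ω).eRk {b 0, b 1} ≤ 1 := by
    calc _ ≤ (AlgebraicIndependent.matroid E Ω).eRk
              ((AlgebraicIndependent.matroid E Ω).closure {c}) := by
            apply Matroid.eRk_mono
            rintro x (rfl | rfl)
            · exact key _ h0
            · exact key _ h1
      _ ≤ 1 := by
            rw [Matroid.eRk_closure_eq]
            exact (Matroid.eRk_le_encard _ _).trans (by simp)
  rw [h2, Set.encard_pair hne] at h3
  norm_num at h3

variable {k : Type*} [Field k] [Algebra k E] [Algebra k Ω] [IsScalarTower k E Ω]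

theorem isAlgebraic_of_ev2 (Z : IntermediateField E Ω) (F : k[X][X]) (hF : F.Monic)
    {τ ξ : Ω} (hτ : τ ∈ Z) (h : ev2 F τ ξ = 0) : IsAlgebraic Z ξ := by
  refine ⟨F.map ((aeval (⟨τ, hτ⟩ : Z) : k[X] →ₐ[k] Z) : k[X] →+* Z), (hF.map _).ne_zero, ?_⟩
  rw [aeval_def, eval₂_map, ← h, ev2]
  congr 1
  apply Polynomial.ringHom_ext
  · intro a; simp; rfl
  · simp

theorem ev2_mem (Z : IntermediateField E Ω) (F : k[X][X])
    {τ ξ : Ω} (hτ : τ ∈ Z) (hξ : ξ ∈ Z) : ev2 F τ ξ ∈ Z := by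
  have := map_ev2 (Z.val.restrictScalars k) F ⟨τ, hτ⟩ ⟨ξ, hξ⟩
  simp only [AlgHom.restrictScalars_apply, IntermediateField.val_mk] at this
  rw [← this]; exact Subtype.property _

theorem eval_map_mem (Z : IntermediateField E Ω) (q : E[X])
    {τ : Ω} (hτ : τ ∈ Z) : (q.map (algebraMap E Ω)).eval τ ∈ Z := by
  rw [eval_map_algebraMap]
  have := Polynomial.aeval_algebraMap_apply Ω (⟨τ, hτ⟩ : Z) q
  rw [show (algebraMap Z Ω) ⟨τ, hτ⟩ = τ from rfl] at this
  rw [this]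
  exact Subtype.property _

theorem derivative_ev2_mem (Z : IntermediateField E Ω) (F : k[X][X])
    {τ ξ : Ω} (hτ : τ ∈ Z) (hξ : ξ ∈ Z) : (derivative (ev2 F X (C ξ))).eval τ ∈ Z := by
  have := mapPoly_ev2 (Z.val.restrictScalars k) F (C ⟨ξ, hξ⟩)
  rw [map_C] at this
  simp only [AlgHom.restrictScalars_apply, RingHom.coe_coe, IntermediateField.val_mk] at this
  rw [← this, derivative_map]
  have h2 := Polynomial.eval₂_at_apply (p := derivative (ev2 F X (C (⟨ξ, hξ⟩ : Z))))
    ((Z.val.restrictScalars k : Z →ₐ[k] Ω) : Z →+* Ω) ⟨τ, hτ⟩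
  rw [eval_map]
  simp only [AlgHom.restrictScalars_apply, RingHom.coe_coe, IntermediateField.val_mk] at h2
  rw [h2]; exact Subtype.property _

theorem ev2_derivative_ne_zero (F : k[X][X])
    (hF : (F.map (algebraMap k[X] (FractionRing k[X]))).Separable)
    {τ ξ : Ω} (hτ : Transcendental k τ) (h : ev2 F τ ξ = 0) : ev2 (derivative F) τ ξ ≠ 0 := by
  have hinj : Function.Injective (aeval τ : k[X] →ₐ[k] Ω) := transcendental_iff_injective.1 hτ
  let g : FractionRing k[X] →+* Ω :=
    IsFractionRing.lift (g := ((aeval τ : k[X] →ₐ[k] Ω) : k[X] →+* Ω)) hinj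
  have hg : g.comp (algebraMap k[X] (FractionRing k[X])) =
      ((aeval τ : k[X] →ₐ[k] Ω) : k[X] →+* Ω) := by
    ext x
    · exact (IsFractionRing.lift_algebraMap hinj (C x))
    · exact (IsFractionRing.lift_algebraMap hinj X)
  have := hF.eval₂_derivative_ne_zero g (x := ξ) (by rw [eval₂_map, hg]; exact h)
  rwa [derivative_map, eval₂_map, hg] at this

/-- Polynomials `F(t, q + w * (b₀ + b₁ t))` only have simple roots away from the roots of `w`. -/
theorem simple_roots (F : k[X][X]) (hmon : F.Monic)
    (hF : (F.map (algebraMap k[X] (FractionRing k[X]))).Separable)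
    {b : Fin 2 → Ω} (hb : AlgebraicIndependent E b) (q w : E[X]) (f : Polynomial Ω)
    (hf : f = q.map (algebraMap E Ω) + w.map (algebraMap E Ω) * (C (b 0) + C (b 1) * X))
    (τ : Ω) (hw : (w.map (algebraMap E Ω)).eval τ ≠ 0)
    (h : (ev2 F X f).eval τ = 0) : (derivative (ev2 F X f)).eval τ ≠ 0 := by
  intro h'
  rw [eval_ev2] at h
  rw [derivative_ev2] at h'
  set ξ := f.eval τ with hξ
  have hξ' : ξ = (q.map (algebraMap E Ω)).eval τ +
      (w.map (algebraMap E Ω)).eval τ * (b 0 + b 1 * τ) := by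
    rw [hξ, hf]; simp
  by_cases hx : ev2 (derivative F) τ ξ = 0
  · have hτ : IsAlgebraic k τ := by
      by_contra hτ
      exact ev2_derivative_ne_zero F hF hτ h hx
    apply not_both_mem_algOver hb (b 1)
    refine ⟨?_, self_mem_algOver _⟩
    have hτZ : τ ∈ algOver E (b 1) := mem_algOver_of_isAlgebraic (hτ.tower_top E)
    have hξZ : ξ ∈ algOver E (b 1) := mem_algOver_trans (isAlgebraic_of_ev2 _ F hmon hτZ h)
    have : b 0 = (ξ - (q.map (algebraMap E Ω)).eval τ) / (w.map (algebraMap E Ω)).eval τ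
        - b 1 * τ := by
      rw [hξ']; field_simp; ring
    rw [this]
    exact sub_mem (div_mem (sub_mem hξZ (eval_map_mem _ _ hτZ)) (eval_map_mem _ _ hτZ))
      (mul_mem (self_mem_algOver _) hτZ)
  · apply not_both_mem_algOver hb τ
    have hτZ : τ ∈ algOver E τ := self_mem_algOver _
    have hξZ : ξ ∈ algOver E τ := mem_algOver_trans (isAlgebraic_of_ev2 _ F hmon hτZ h)
    have hqZ := eval_map_mem (algOver E τ) q hτZ
    have hwZ := eval_map_mem (algOver E τ) w hτZ
    have hqZ' := eval_map_mem (algOver E τ) (derivative q) hτZ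
    have hwZ' := eval_map_mem (algOver E τ) (derivative w) hτZ
    set y := b 0 + b 1 * τ with hy
    have hyZ : y ∈ algOver E τ := by
      have : y = (ξ - (q.map (algebraMap E Ω)).eval τ) / (w.map (algebraMap E Ω)).eval τ := by
        rw [hξ']; field_simp; ring
      rw [this]
      exact div_mem (sub_mem hξZ hqZ) hwZ
    have hd : (derivative f).eval τ = (map (algebraMap E Ω) (derivative q)).eval τ +
        (map (algebraMap E Ω) (derivative w)).eval τ * y +
          (w.map (algebraMap E Ω)).eval τ * b 1 := by
      rw [hf]; simp [derivative_map, hy]; ring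
    have hdZ : (derivative f).eval τ ∈ algOver E τ := by
      have : (derivative f).eval τ = - (derivative (ev2 F X (C ξ))).eval τ /
          ev2 (derivative F) τ ξ := by
        field_simp
        linear_combination h'
      rw [this]
      exact div_mem (neg_mem (derivative_ev2_mem _ F hτZ hξZ)) (ev2_mem _ _ hτZ hξZ)
    have h1 : b 1 ∈ algOver E τ := by
      have : b 1 = ((derivative f).eval τ - (map (algebraMap E Ω) (derivative q)).eval τ -
        (map (algebraMap E Ω) (derivative w)).eval τ * y) / (w.map (algebraMap E Ω)).eval τ := by
        rw [hd]; field_simp; ring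
      rw [this]
      exact div_mem (sub_mem (sub_mem hdZ hqZ') (mul_mem hwZ' hyZ)) hwZ
    refine ⟨?_, h1⟩
    have : b 0 = y - b 1 * τ := by rw [hy]; ring
    rw [this]
    exact sub_mem hyZ (mul_mem h1 hτZ)

end Trdeg

section Irreducibility

theorem exists_algHom_of_finiteType {k A : Type*} [Field k] [IsAlgClosed k] [CommRing A]
    [Nontrivial A] [Algebra k A] [Algebra.FiniteType k A] : Nonempty (A →ₐ[k] k) := by
  obtain ⟨m, hm⟩ := Ideal.exists_maximal A
  let : Field (A ⧸ m) := Ideal.Quotient.field m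
  have : Algebra.FiniteType k (A ⧸ m) :=
    Algebra.FiniteType.of_surjective (Ideal.Quotient.mkₐ k m) (Ideal.Quotient.mkₐ_surjective k m)
  have : Module.Finite k (A ⧸ m) := finite_of_finite_type_of_isJacobsonRing k (A ⧸ m)
  exact ⟨(IsAlgClosed.lift : (A ⧸ m) →ₐ[k] k).comp (Ideal.Quotient.mkₐ k m)⟩

theorem mem_lifts_of_coeffs {A E : Type*} [CommRing A] [CommRing E] (i : A →+* E)
    (f : E[X][X]) (h : ∀ a b, (f.coeff a).coeff b ∈ i.range) :
    f ∈ lifts (mapRingHom i) := by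
  rw [lifts_iff_coeff_lifts]
  intro a
  have : f.coeff a ∈ lifts i := by
    rw [lifts_iff_coeff_lifts]
    intro b
    exact h a b
  rw [mem_lifts] at this
  exact this

theorem irreducible_extend {k E : Type*} [Field k] [IsAlgClosed k] [Field E] [Algebra k E]
    (F : k[X][X]) (hmon : F.Monic) (hirr : Irreducible F) :
    Irreducible (F.map (mapRingHom (algebraMap k E))) := by
  have hmon' := hmon.map (mapRingHom (algebraMap k E))
  rw [hmon'.irreducible_iff_natDegree']
  rw [hmon.irreducible_iff_natDegree'] at hirr
  refine ⟨fun h => hirr.1 ?_, ?_⟩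
  · have h0 : F.natDegree = 0 := by
      rw [← hmon.natDegree_map (mapRingHom (algebraMap k E)), h, natDegree_one]
    exact hmon.natDegree_eq_zero.1 h0
  intro f g hf hg hfg
  classical
  let T : Finset E := (f.coeffs.biUnion fun c => c.coeffs) ∪ (g.coeffs.biUnion fun c => c.coeffs)
  let A := Algebra.adjoin k (T : Set E)
  have : Algebra.FiniteType k A := (Subalgebra.fg_iff_finiteType _).1 ⟨T, rfl⟩
  let i : A →+* E := algebraMap A E
  have hi : Function.Injective i := Subtype.val_injective
  have hT : ∀ h : E[X][X], (h.coeffs.biUnion fun c => c.coeffs) ⊆ T →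
      ∀ a b, (h.coeff a).coeff b ∈ i.range := by
    intro h hh a b
    by_cases hab : (h.coeff a).coeff b = 0
    · rw [hab]; exact zero_mem _
    have ha : h.coeff a ≠ 0 := fun e => hab (by simp [e])
    have : (h.coeff a).coeff b ∈ T := by
      apply hh
      rw [Finset.mem_biUnion]
      exact ⟨_, coeff_mem_coeffs ha, coeff_mem_coeffs hab⟩
    exact ⟨⟨_, Algebra.subset_adjoin this⟩, rfl⟩
  obtain ⟨f', hf1, hf2, hf3⟩ := lifts_and_natDegree_eq_and_monic
    (mem_lifts_of_coeffs i f (hT f Finset.subset_union_left)) hf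
  obtain ⟨g', hg1, hg2, hg3⟩ := lifts_and_natDegree_eq_and_monic
    (mem_lifts_of_coeffs i g (hT g Finset.subset_union_right)) hg
  have hprod : f' * g' = F.map (mapRingHom (algebraMap k A)) := by
    apply Polynomial.map_injective (mapRingHom i) (Polynomial.map_injective i hi)
    rw [Polynomial.map_mul, hf1, hg1, hfg, Polynomial.map_map, mapRingHom_comp]
    rfl
  obtain ⟨φ⟩ := exists_algHom_of_finiteType (k := k) (A := A)
  have := hirr.2 (f'.map (mapRingHom (φ : A →+* k))) (g'.map (mapRingHom (φ : A →+* k)))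
    (hf3.map _) (hg3.map _) (by
      rw [← Polynomial.map_mul, hprod, Polynomial.map_map, mapRingHom_comp]
      have : (φ : A →+* k).comp (algebraMap k A) = RingHom.id k := by ext; simp
      rw [this, mapRingHom_id, Polynomial.map_id])
  rwa [hg3.natDegree_map, hg2, ← hmon.natDegree_map (mapRingHom (algebraMap k E))] at this

theorem exists_generic {k : Type u} {E : Type u} {L : Type u} [Field k] [IsAlgClosed k] [Field E]
    [Field L] [Algebra k E] [Algebra k L]
    (F : k[X][X]) (hmon : F.Monic) (hirr : Irreducible F) :
    ∃ (E' : Type u) (_ : Field E') (_ : Algebra k E') (ι : E →ₐ[k] E') (t x : E'),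
      ∀ (i : E →ₐ[k] L) (τ ξ : L),
        (∀ h : E[X], eval₂ (i : E →+* L) τ h = 0 → h = 0) → ev2 F τ ξ = 0 →
        ∃ J : E' →ₐ[k] L, J.comp ι = i ∧ J t = τ ∧ J x = ξ ∧
          ∀ Z : Subfield L, (∀ e, i e ∈ Z) → τ ∈ Z → ξ ∈ Z → ∀ z, J z ∈ Z := by
  set P : E[X][X] := F.map (mapRingHom (algebraMap k E)) with hP
  have hPirr : Irreducible P := irreducible_extend F hmon hirr
  have hPmon : P.Monic := hmon.map _
  have : IsDomain (AdjoinRoot P) := AdjoinRoot.isDomain_of_prime hPirr.prime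
  refine ⟨FractionRing (AdjoinRoot P), inferInstance, inferInstance,
    IsScalarTower.toAlgHom k E (FractionRing (AdjoinRoot P)),
    algebraMap (AdjoinRoot P) _ (AdjoinRoot.of P X), algebraMap (AdjoinRoot P) _ (AdjoinRoot.root P),
    ?_⟩
  intro i τ ξ hτ hF
  have hinj : Function.Injective (eval₂RingHom (i : E →+* L) τ) := by
    rw [injective_iff_map_eq_zero]; exact hτ
  have hPev : eval₂ (eval₂RingHom (i : E →+* L) τ) ξ P = 0 := by
    rw [hP, eval₂_map, ← hF, ev2]
    congr 1
    apply Polynomial.ringHom_ext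
    · intro a; simp
    · simp
  let g : AdjoinRoot P →+* L := AdjoinRoot.lift (eval₂RingHom (i : E →+* L) τ) ξ hPev
  have hg : Function.Injective g := by
    rw [injective_iff_map_eq_zero]
    intro a
    induction a using AdjoinRoot.induction_on with
    | ih H =>
      intro h0
      rw [AdjoinRoot.mk_eq_zero]
      replace h0 : eval₂ (eval₂RingHom (i : E →+* L) τ) ξ H = 0 := by
        simpa [g] using h0
      let gQ : FractionRing E[X] →+* L := IsFractionRing.lift hinj
      have hgQ : gQ.comp (algebraMap E[X] (FractionRing E[X])) = eval₂RingHom (i : E →+* L) τ :=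
        RingHom.ext fun x => IsFractionRing.lift_algebraMap hinj x
      let : Algebra (FractionRing E[X]) L := gQ.toAlgebra
      have e1 : ∀ Q : E[X][X], aeval ξ (Q.map (algebraMap E[X] (FractionRing E[X]))) =
          eval₂ (eval₂RingHom (i : E →+* L) τ) ξ Q := by
        intro Q
        rw [aeval_def, eval₂_map, ← hgQ]; rfl
      have hm := minpoly.eq_of_irreducible_of_monic (A := FractionRing E[X]) (x := ξ)
        (p := P.map (algebraMap E[X] (FractionRing E[X])))
        (hPmon.irreducible_iff_irreducible_map_fraction_map.1 hPirr)
        (by rw [e1, hPev]) (hPmon.map _)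
      have hd : P.map (algebraMap E[X] (FractionRing E[X])) ∣
          H.map (algebraMap E[X] (FractionRing E[X])) := by
        rw [hm]; apply minpoly.dvd; rw [e1, h0]
      exact (Polynomial.map_dvd_map _ (IsFractionRing.injective E[X] (FractionRing E[X])) hPmon).1 hd
  have hgE : ∀ e : E, g (algebraMap E (AdjoinRoot P) e) = i e := by
    intro e
    have : algebraMap E (AdjoinRoot P) e = AdjoinRoot.of P (C e) := rfl
    rw [this]
    simp [g]
  have hgk : ∀ c : k, g (algebraMap k (AdjoinRoot P) c) = algebraMap k L c := by
    intro c
    rw [IsScalarTower.algebraMap_apply k E (AdjoinRoot P), hgE, AlgHom.commutes]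
  let gk : AdjoinRoot P →ₐ[k] L := { g with commutes' := hgk }
  let J : FractionRing (AdjoinRoot P) →ₐ[k] L := IsFractionRing.liftAlgHom (g := gk) hg
  have hJ : ∀ a, J (algebraMap (AdjoinRoot P) _ a) = g a := fun a =>
    IsFractionRing.lift_algebraMap (g := (gk : AdjoinRoot P →+* L)) hg a
  refine ⟨J, ?_, ?_, ?_, ?_⟩
  · ext e
    simp only [AlgHom.comp_apply, IsScalarTower.coe_toAlgHom']
    rw [IsScalarTower.algebraMap_apply E (AdjoinRoot P), hJ, hgE]
  · rw [hJ]; simp [g]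
  · rw [hJ]; simp [g]
  · intro Z h1 h2 h3 z
    obtain ⟨a, b, rfl⟩ := IsLocalization.exists_mk'_eq (nonZeroDivisors (AdjoinRoot P)) z
    have key : ∀ a, g a ∈ Z := by
      intro a
      induction a using AdjoinRoot.induction_on with
      | ih H =>
        have : g (AdjoinRoot.mk P H) = eval₂ (eval₂RingHom (i : E →+* L) τ) ξ H := by simp [g]
        rw [this, eval₂_eq_sum]
        refine sum_mem fun n _ => mul_mem ?_ (pow_mem h3 n)
        simp only [coe_eval₂RingHom]
        rw [eval₂_eq_sum]
        exact sum_mem fun n _ => mul_mem (h1 _) (pow_mem h2 n)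
    rw [IsFractionRing.mk'_eq_div, map_div₀, hJ, hJ]
    exact div_mem (key _) (key _)

end Irreducibility



section TwoTransitive

/-- Two pairs of distinct roots of `F(t,f)` are conjugate. -/
theorem exists_algEquiv_pair {k E K L : Type u} [Field k] [IsAlgClosed k] [Field E]
    [Field K] [Field L] [Algebra k E] [Algebra k K] [Algebra k L] [Algebra E L] [Algebra K L]
    [IsScalarTower k E L] [IsScalarTower k K L] [Normal K L]
    (F : k[X][X]) (hmon : F.Monic) (hirr : Irreducible F)
    {b : Fin 2 → L} (hb : AlgebraicIndependent E b) (q : E[X]) (f : L[X])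
    (hf : f = q.map (algebraMap E L) + (C (b 0) + C (b 1) * X))
    (hgen : ∀ Z : Subfield L, (∀ e, algebraMap E L e ∈ Z) → b 0 ∈ Z → b 1 ∈ Z →
      ∀ a, algebraMap K L a ∈ Z)
    {τ₁ τ₂ τ₁' τ₂' : L} (hne : τ₁ ≠ τ₂) (hne' : τ₁' ≠ τ₂')
    (h₁ : (ev2 F X f).eval τ₁ = 0) (h₂ : (ev2 F X f).eval τ₂ = 0)
    (h₁' : (ev2 F X f).eval τ₁' = 0) (h₂' : (ev2 F X f).eval τ₂' = 0) :
    ∃ σ : L ≃ₐ[K] L, σ τ₁ = τ₁' ∧ σ τ₂ = τ₂' := by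
  have hfe : ∀ τ, f.eval τ = (q.map (algebraMap E L)).eval τ + (b 0 + b 1 * τ) := by
    intro τ; rw [hf]; simp
  -- transcendence
  have hb1 : ∀ τ τ', τ ≠ τ' → b 1 = ((f.eval τ - (q.map (algebraMap E L)).eval τ) -
      (f.eval τ' - (q.map (algebraMap E L)).eval τ')) / (τ - τ') := by
    intro τ τ' h
    have : τ - τ' ≠ 0 := sub_ne_zero.2 h
    rw [hfe, hfe]; field_simp; ring
  have hb0 : ∀ τ, b 0 = f.eval τ - (q.map (algebraMap E L)).eval τ - b 1 * τ := by
    intro τ; rw [hfe]; ring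
  have key : ∀ c τ τ' : L, τ ≠ τ' → (ev2 F X f).eval τ = 0 → (ev2 F X f).eval τ' = 0 →
      τ ∈ algOver E c → τ' ∈ algOver E c → False := by
    intro c τ τ' hne h h' hc hc'
    rw [eval_ev2] at h h'
    have m := mem_algOver_trans (isAlgebraic_of_ev2 _ F hmon hc h)
    have m' := mem_algOver_trans (isAlgebraic_of_ev2 _ F hmon hc' h')
    have m1 : b 1 ∈ algOver E c := by
      rw [hb1 τ τ' hne]
      exact div_mem (sub_mem (sub_mem m (eval_map_mem _ _ hc)) (sub_mem m' (eval_map_mem _ _ hc')))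
        (sub_mem hc hc')
    have m0 : b 0 ∈ algOver E c := by
      rw [hb0 τ]
      exact sub_mem (sub_mem m (eval_map_mem _ _ hc)) (mul_mem m1 hc)
    exact not_both_mem_algOver hb c ⟨m0, m1⟩
  have tr1 : ∀ τ τ' : L, τ ≠ τ' → (ev2 F X f).eval τ = 0 → (ev2 F X f).eval τ' = 0 →
      ∀ h : E[X], eval₂ ((IsScalarTower.toAlgHom k E L : E →ₐ[k] L) : E →+* L) τ h = 0 → h = 0 := by
    intro τ τ' hne h h' p hp
    by_contra hp0
    have : IsAlgebraic E τ := ⟨p, hp0, hp⟩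
    exact key τ' τ τ' hne h h' (mem_algOver_of_isAlgebraic this) (self_mem_algOver _)
  obtain ⟨E₁, _, _, ι₁, t₁, x₁, H₁⟩ := exists_generic (E := E) (L := L) F hmon hirr
  obtain ⟨E₂, _, _, ι₂, t₂, x₂, H₂⟩ := exists_generic (E := E₁) (L := L) F hmon hirr
  have step : ∀ τ₁ τ₂ : L, τ₁ ≠ τ₂ → (ev2 F X f).eval τ₁ = 0 → (ev2 F X f).eval τ₂ = 0 →
      ∃ J : E₂ →ₐ[k] L, (∀ e, J (ι₂ (ι₁ e)) = algebraMap E L e) ∧ J (ι₂ t₁) = τ₁ ∧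
        J (ι₂ x₁) = f.eval τ₁ ∧ J t₂ = τ₂ ∧ J x₂ = f.eval τ₂ := by
    intro τ₁ τ₂ hne h₁ h₂
    obtain ⟨J₁, a1, a2, a3, a4⟩ := H₁ (IsScalarTower.toAlgHom k E L) τ₁ (f.eval τ₁)
      (tr1 τ₁ τ₂ hne h₁ h₂) (by rw [← eval_ev2]; exact h₁)
    have hmem : ∀ z, J₁ z ∈ algOver E τ₁ := by
      have hc : τ₁ ∈ algOver E τ₁ := self_mem_algOver _
      refine a4 (algOver E τ₁).toSubfield (fun e => (algOver E τ₁).algebraMap_mem e) hc ?_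
      rw [eval_ev2] at h₁
      exact mem_algOver_trans (isAlgebraic_of_ev2 _ F hmon hc h₁)
    obtain ⟨J, c1, c2, c3, -⟩ := H₂ J₁ τ₂ (f.eval τ₂) (by
      intro p hp
      by_contra hp0
      have hc : τ₁ ∈ algOver E τ₁ := self_mem_algOver _
      refine key τ₁ τ₁ τ₂ hne h₁ h₂ hc (mem_algOver_trans ?_)
      let j : E₁ →+* algOver E τ₁ :=
        (J₁ : E₁ →+* L).codRestrict (algOver E τ₁).toSubfield hmem
      refine ⟨p.map j, (Polynomial.map_ne_zero_iff j.injective).2 hp0, ?_⟩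
      rw [aeval_def, eval₂_map, ← hp]
      rfl) (by rw [← eval_ev2]; exact h₂)
    have c1' : ∀ z, J (ι₂ z) = J₁ z := fun z => by rw [← c1]; rfl
    refine ⟨J, fun e => ?_, ?_, ?_, c2, c3⟩
    · rw [c1', ← AlgHom.comp_apply, a1]; rfl
    · rw [c1', a2]
    · rw [c1', a3]
  obtain ⟨J, p1, p2, p3, p4, p5⟩ := step τ₁ τ₂ hne h₁ h₂
  obtain ⟨J', p1', p2', p3', p4', p5'⟩ := step τ₁' τ₂' hne' h₁' h₂'
  let Z : Subfield L := ((J : E₂ →+* L).eqLocusField (J' : E₂ →+* L)).map (J : E₂ →+* L)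
  have hZ : ∀ y, J y = J' y → J y ∈ Z := fun y hy => ⟨y, hy, rfl⟩
  have qJ : ∀ (M : E₂ →ₐ[k] L) (_ : ∀ e, M (ι₂ (ι₁ e)) = algebraMap E L e) (y : E₂),
      M ((q.map ((ι₂ : E₁ →+* E₂).comp (ι₁ : E →+* E₁))).eval y) =
        (q.map (algebraMap E L)).eval (M y) := by
    intro M hM y
    have e1 := Polynomial.hom_eval₂ q ((ι₂ : E₁ →+* E₂).comp (ι₁ : E →+* E₁)) (M : E₂ →+* L) y
    rw [eval_map, eval_map]
    refine e1.trans ?_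
    congr 1
    ext e
    exact hM e
  let β₁ : E₂ := ((ι₂ x₁ - (q.map ((ι₂ : E₁ →+* E₂).comp (ι₁ : E →+* E₁))).eval (ι₂ t₁)) -
      (x₂ - (q.map ((ι₂ : E₁ →+* E₂).comp (ι₁ : E →+* E₁))).eval t₂)) / (ι₂ t₁ - t₂)
  let β₀ : E₂ := ι₂ x₁ - (q.map ((ι₂ : E₁ →+* E₂).comp (ι₁ : E →+* E₁))).eval (ι₂ t₁)
    - β₁ * ι₂ t₁
  have Jβ₁ : J β₁ = b 1 := by
    simp only [β₁, map_div₀, map_sub, qJ J p1, p2, p3, p4, p5]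
    exact (hb1 _ _ hne).symm
  have Jβ₁' : J' β₁ = b 1 := by
    simp only [β₁, map_div₀, map_sub, qJ J' p1', p2', p3', p4', p5']
    exact (hb1 _ _ hne').symm
  have Jβ₀ : J β₀ = b 0 := by
    simp only [β₀, map_mul, map_sub, qJ J p1, p2, p3, Jβ₁]
    exact (hb0 _).symm
  have Jβ₀' : J' β₀ = b 0 := by
    simp only [β₀, map_mul, map_sub, qJ J' p1', p2', p3', Jβ₁']
    exact (hb0 _).symm
  have hK := hgen Z (fun e => ⟨ι₂ (ι₁ e), (p1 e).trans (p1' e).symm, p1 e⟩)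
    ⟨β₀, Jβ₀.trans Jβ₀'.symm, Jβ₀⟩ ⟨β₁, Jβ₁.trans Jβ₁'.symm, Jβ₁⟩
  have hK' : ∀ a, ∃ y, J y = algebraMap K L a ∧ J' y = algebraMap K L a := by
    intro a
    obtain ⟨y, hy, hy'⟩ := hK a
    exact ⟨y, hy', hy.symm.trans hy'⟩
  choose s hs hs' using hK'
  have Jinj : Function.Injective J := J.toRingHom.injective
  let sR : K →+* E₂ :=
    { toFun := s
      map_one' := Jinj (by rw [hs]; simp)
      map_zero' := Jinj (by rw [hs]; simp)
      map_mul' := fun x y => Jinj (by rw [hs, map_mul, map_mul, hs, hs])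
      map_add' := fun x y => Jinj (by rw [hs, map_add, map_add, hs, hs]) }
  let _ : Algebra K E₂ := sR.toAlgebra
  let _ : Algebra E₂ L := (J : E₂ →+* L).toAlgebra
  have : IsScalarTower K E₂ L := IsScalarTower.of_algebraMap_eq fun x => (hs x).symm
  let ψ : E₂ →ₐ[K] L := { (J' : E₂ →+* L) with commutes' := fun a => hs' a }
  let σ : L →ₐ[K] L := ψ.liftNormal L
  have hσ : ∀ y, σ (J y) = J' y := fun y => ψ.liftNormal_commutes L y
  refine ⟨AlgEquiv.ofBijective σ (Algebra.IsAlgebraic.algHom_bijective σ), ?_, ?_⟩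
  · rw [AlgEquiv.coe_ofBijective, ← p2, hσ, p2']
  · rw [AlgEquiv.coe_ofBijective, ← p4, hσ, p4']

end TwoTransitive


section Degree

variable {k S : Type*} [CommRing k] [CommRing S] [Algebra k S]

/-- The polynomial giving the top coefficient of `F(t,f)` in terms of the top coefficient of `f`. -/
noncomputable def leadPoly (F : k[X][X]) (n : ℕ) : k[X] :=
  ∑ j ∈ Finset.range (F.natDegree + 1), C ((F.coeff j).coeff ((F.natDegree - j) * n)) * X ^ j

theorem ev2_X_eq_sum (F : k[X][X]) (f : S[X]) :
    ev2 F X f = ∑ j ∈ Finset.range (F.natDegree + 1),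
      (F.coeff j).map (algebraMap k S) * f ^ j := by
  rw [ev2, eval₂_eq_sum_range]
  refine Finset.sum_congr rfl fun j _ => ?_
  congr 1

theorem leadPoly_ne_zero [Nontrivial k] (F : k[X][X]) (hF : F.Monic) (n : ℕ) :
    leadPoly F n ≠ 0 := by
  intro h
  have h1 : (leadPoly F n).coeff F.natDegree = 1 := by
    rw [leadPoly, finsetSum_coeff, Finset.sum_eq_single F.natDegree]
    · simp [hF.coeff_natDegree]
    · intro j _ hj
      simp [coeff_X_pow, hj.symm]
    · simp
  rw [h] at h1
  simp at h1

theorem natDegree_ev2_le (F : k[X][X]) (n : ℕ) (f : S[X]) (hf : f.natDegree ≤ n)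
    (hF : ∀ j ≤ F.natDegree, (F.coeff j).natDegree ≤ (F.natDegree - j) * n) :
    (ev2 F X f).natDegree ≤ F.natDegree * n := by
  rw [ev2_X_eq_sum]
  refine natDegree_sum_le_of_forall_le _ _ fun j hj => ?_
  have hj' : j ≤ F.natDegree := by simpa [Nat.lt_succ_iff] using hj
  refine (natDegree_mul_le_of_le (natDegree_map_le.trans (hF j hj'))
    (natDegree_pow_le_of_le j hf)).trans ?_
  rw [← add_mul, Nat.sub_add_cancel hj']

theorem coeff_ev2 (F : k[X][X]) (n : ℕ) (f : S[X]) (hf : f.natDegree ≤ n)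
    (hF : ∀ j ≤ F.natDegree, (F.coeff j).natDegree ≤ (F.natDegree - j) * n) :
    (ev2 F X f).coeff (F.natDegree * n) = aeval (f.coeff n) (leadPoly F n) := by
  rw [ev2_X_eq_sum, finsetSum_coeff, leadPoly, map_sum]
  refine Finset.sum_congr rfl fun j hj => ?_
  have hj' : j ≤ F.natDegree := by simpa [Nat.lt_succ_iff] using hj
  have e : F.natDegree * n = (F.natDegree - j) * n + j * n := by
    rw [← add_mul, Nat.sub_add_cancel hj']
  rw [e, coeff_mul_add_eq_of_natDegree_le (natDegree_map_le.trans (hF j hj'))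
    (natDegree_pow_le_of_le j hf), coeff_pow_of_natDegree_le hf]
  simp

theorem leadingCoeff_ev2_ne_zero {k S : Type*} [Field k] [CommRing S] [Algebra k S]
    (F : k[X][X]) (hmon : F.Monic) (n : ℕ) (f : S[X]) 
    (ht : Transcendental k (f.coeff n)) :
    aeval (f.coeff n) (leadPoly F n) ≠ 0 := by
  intro h
  exact leadPoly_ne_zero F hmon n ((transcendental_iff.1 ht) _ h)

theorem natDegree_ev2_eq {k S : Type*} [Field k] [CommRing S] [Algebra k S]
    (F : k[X][X]) (hmon : F.Monic) (n : ℕ) (f : S[X]) (hf : f.natDegree ≤ n)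
    (hF : ∀ j ≤ F.natDegree, (F.coeff j).natDegree ≤ (F.natDegree - j) * n)
    (ht : Transcendental k (f.coeff n)) :
    (ev2 F X f).natDegree = F.natDegree * n := by
  refine le_antisymm (natDegree_ev2_le F n f hf hF) (le_natDegree_of_ne_zero ?_)
  rw [coeff_ev2 F n f hf hF]
  exact leadingCoeff_ev2_ne_zero F hmon n f ht

end Degree


section Transposition

theorem hensel_root {Ω : Type*} [Field Ω] (P : Polynomial (PowerSeries Ω))
    (hP : IsUnit P.leadingCoeff) (a : Ω)
    (h : (P.map PowerSeries.constantCoeff).eval a = 0)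
    (h' : (derivative (P.map PowerSeries.constantCoeff)).eval a ≠ 0) :
    ∃ θ : PowerSeries Ω, P.eval θ = 0 ∧ PowerSeries.constantCoeff θ = a := by
  obtain ⟨v, hv⟩ := hP
  have hmon : (C (↑v⁻¹ : PowerSeries Ω) * P).Monic := by
    apply monic_C_mul_of_mul_leadingCoeff_eq_one
    rw [← hv, Units.inv_mul]
  have hcc : ∀ Q : Polynomial (PowerSeries Ω), PowerSeries.constantCoeff (Q.eval (PowerSeries.C a)) =
      (Q.map PowerSeries.constantCoeff).eval a := by
    intro Q
    have := (eval_map_apply (f := (PowerSeries.constantCoeff (R := Ω))) (p := Q) (PowerSeries.C a)).symm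
    simpa using this
  have hu : IsUnit ((C (↑v⁻¹ : PowerSeries Ω) * derivative P).eval (PowerSeries.C a)) := by
    rw [PowerSeries.isUnit_iff_constantCoeff, isUnit_iff_ne_zero, eval_mul, eval_C, map_mul, hcc,
      ← derivative_map]
    refine mul_ne_zero ?_ h'
    exact ((Units.isUnit v⁻¹).map (PowerSeries.constantCoeff (R := Ω))).ne_zero
  obtain ⟨θ, h1, h2⟩ := HenselianRing.is_henselian (I := Ideal.span {(PowerSeries.X : PowerSeries Ω)})
    (C (↑v⁻¹ : PowerSeries Ω) * P) hmon (PowerSeries.C a)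
    (by
      rw [Ideal.mem_span_singleton, PowerSeries.X_dvd_iff, eval_mul, map_mul, hcc P, h, mul_zero])
    (by
      rw [derivative_C_mul]
      exact hu.map _)
  refine ⟨θ, ?_, ?_⟩
  · rw [IsRoot.def, eval_mul, eval_C] at h1
    exact (Units.mul_right_eq_zero v⁻¹).1 h1
  · rw [Ideal.mem_span_singleton, PowerSeries.X_dvd_iff, map_sub, sub_eq_zero] at h2
    simpa using h2

theorem exists_roots_finset {Ω : Type*} [Field Ω] [IsAlgClosed Ω] (P : Polynomial (PowerSeries Ω))
    (hP : IsUnit P.leadingCoeff) (t₀ : Ω)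
    (hs : ∀ a, a ≠ t₀ → (P.map PowerSeries.constantCoeff).eval a = 0 →
      (derivative (P.map PowerSeries.constantCoeff)).eval a ≠ 0) :
    ∃ S : Finset (PowerSeries Ω), (∀ θ ∈ S, P.eval θ = 0) ∧
      P.natDegree ≤ S.card + (P.map PowerSeries.constantCoeff).rootMultiplicity t₀ := by
  classical
  set Q := P.map PowerSeries.constantCoeff with hQ
  have hlc : (PowerSeries.constantCoeff (R := Ω)) P.leadingCoeff ≠ 0 :=
    (hP.map (PowerSeries.constantCoeff (R := Ω))).ne_zero
  have hQ0 : Q ≠ 0 := by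
    intro h
    rw [← leadingCoeff_map_of_leadingCoeff_ne_zero _ hlc, ← hQ, h] at hlc
    simp at hlc
  have hdeg : Q.natDegree = P.natDegree := natDegree_map_of_leadingCoeff_ne_zero _ hlc
  have hex : ∀ a, ∃ θ : PowerSeries Ω, a ∈ Q.roots.toFinset.erase t₀ →
      P.eval θ = 0 ∧ PowerSeries.constantCoeff θ = a := by
    intro a
    by_cases ha : a ∈ Q.roots.toFinset.erase t₀
    · have h1 := Finset.mem_erase.1 ha
      have h2 : Q.eval a = 0 := by
        have := h1.2
        rw [Multiset.mem_toFinset, mem_roots hQ0] at this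
        exact this
      obtain ⟨θ, hθ⟩ := hensel_root P hP a h2 (hs a h1.1 h2)
      exact ⟨θ, fun _ => hθ⟩
    · exact ⟨0, fun h => absurd h ha⟩
  choose g hg using hex
  refine ⟨(Q.roots.toFinset.erase t₀).image g, ?_, ?_⟩
  · intro θ hθ
    obtain ⟨a, ha, rfl⟩ := Finset.mem_image.1 hθ
    exact (hg a ha).1
  · rw [Finset.card_image_of_injOn]
    · rw [← hdeg, (IsAlgClosed.splits Q).natDegree_eq_card_roots,
        ← Multiset.toFinset_sum_count_eq]
      have h1 : ∑ a ∈ Q.roots.toFinset.erase t₀, Multiset.count a Q.roots ≤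
          (Q.roots.toFinset.erase t₀).card := by
        rw [Finset.card_eq_sum_ones]
        refine Finset.sum_le_sum fun a ha => ?_
        rw [count_roots]
        by_contra hlt
        have := (one_lt_rootMultiplicity_iff_isRoot hQ0).1 (not_le.1 hlt)
        exact hs a (Finset.mem_erase.1 ha).1 this.1 this.2
      rw [← count_roots]
      by_cases ht : t₀ ∈ Q.roots.toFinset
      · rw [← Finset.sum_erase_add _ _ ht]
        omega
      · rw [Finset.erase_eq_of_notMem ht] at h1 ⊢
        omega
    · intro a ha b hb hab
      rw [← (hg a ha).2, ← (hg b hb).2, hab]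

theorem exists_transposition {Ω Λ M ι : Type*} [Field Ω] [IsAlgClosed Ω] [Field Λ] [Field M]
    [Algebra (PowerSeries Ω) Λ] [IsFractionRing (PowerSeries Ω) Λ] [Algebra Λ M]
    [IsAlgClosed M] [Normal Λ M]
    (P : ι → Polynomial (PowerSeries Ω)) (hP : ∀ j, IsUnit (P j).leadingCoeff) (t₀ : Ω) (i : ι)
    (hs : ∀ j a, a ≠ t₀ → ((P j).map PowerSeries.constantCoeff).eval a = 0 →
      (derivative ((P j).map PowerSeries.constantCoeff)).eval a ≠ 0)
    (hother : ∀ j, j ≠ i → ((P j).map PowerSeries.constantCoeff).eval t₀ ≠ 0)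
    (hi : ((P i).map PowerSeries.constantCoeff).eval t₀ = 0)
    (hi2 : ((P i).map PowerSeries.constantCoeff).rootMultiplicity t₀ ≤ 2)
    (hno : ∀ θ, (P i).eval θ = 0 → PowerSeries.constantCoeff θ ≠ t₀)
    (hsep : ((P i).map (algebraMap (PowerSeries Ω) Λ)).Separable) :
    ∃ (σ : M ≃ₐ[Λ] M) (β γ : M), β ≠ γ ∧
      (((P i).map (algebraMap (PowerSeries Ω) Λ)).map (algebraMap Λ M)).eval β = 0 ∧
      (((P i).map (algebraMap (PowerSeries Ω) Λ)).map (algebraMap Λ M)).eval γ = 0 ∧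
      σ β = γ ∧ σ γ = β ∧ ∀ j θ,
        (((P j).map (algebraMap (PowerSeries Ω) Λ)).map (algebraMap Λ M)).eval θ = 0 →
        θ ≠ β → θ ≠ γ → σ θ = θ := by
  classical
  set g : PowerSeries Ω →+* M := (algebraMap Λ M).comp (algebraMap (PowerSeries Ω) Λ) with hg
  have hginj : Function.Injective g :=
    (algebraMap Λ M).injective.comp (IsFractionRing.injective (PowerSeries Ω) Λ)
  simp only [Polynomial.map_map, ← hg]
  have hP0 : ∀ j, P j ≠ 0 := fun j h => by
    have := hP j
    rw [h, leadingCoeff_zero] at this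
    exact not_isUnit_zero this
  have hPg0 : ∀ j, (P j).map g ≠ 0 := fun j => (Polynomial.map_ne_zero_iff hginj).2 (hP0 j)
  -- few roots outside of the image
  have hfew : ∀ j, ((((P j).map g).roots.toFinset).filter (fun x => x ∉ Set.range g)).card ≤
      ((P j).map PowerSeries.constantCoeff).rootMultiplicity t₀ := by
    intro j
    obtain ⟨S, hS, hc⟩ := exists_roots_finset (P j) (hP j) t₀ (hs j)
    have hsub : (((P j).map g).roots.toFinset).filter (fun x => x ∉ Set.range g) ∪ S.image g ⊆
        ((P j).map g).roots.toFinset := by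
      refine Finset.union_subset (Finset.filter_subset _ _) ?_
      intro x hx
      obtain ⟨θ, hθ, rfl⟩ := Finset.mem_image.1 hx
      rw [Multiset.mem_toFinset, mem_roots (hPg0 j), IsRoot.def, eval_map_apply, hS θ hθ, map_zero]
    have hdis : Disjoint ((((P j).map g).roots.toFinset).filter (fun x => x ∉ Set.range g))
        (S.image g) := by
      rw [Finset.disjoint_left]
      intro x hx hx'
      obtain ⟨θ, hθ, rfl⟩ := Finset.mem_image.1 hx'
      exact (Finset.mem_filter.1 hx).2 ⟨θ, rfl⟩
    have h1 := Finset.card_le_card hsub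
    rw [Finset.card_union_of_disjoint hdis, Finset.card_image_of_injective _ hginj] at h1
    have h2 := Multiset.toFinset_card_le ((P j).map g).roots
    have h3 := card_roots' ((P j).map g)
    rw [natDegree_map_eq_of_injective hginj] at h3
    omega
  have hmem : ∀ j θ, ((P j).map g).eval θ = 0 → θ ∉ Set.range g →
      θ ∈ (((P j).map g).roots.toFinset).filter (fun x => x ∉ Set.range g) := by
    intro j θ h1 h2
    rw [Finset.mem_filter, Multiset.mem_toFinset, mem_roots (hPg0 j)]
    exact ⟨h1, h2⟩
  have hrat : ∀ j, j ≠ i → ∀ θ, ((P j).map g).eval θ = 0 → θ ∈ Set.range g := by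
    intro j hj θ h
    by_contra hn
    have h1 := hfew j
    rw [rootMultiplicity_eq_zero (hother j hj), Nat.le_zero, Finset.card_eq_zero] at h1
    have := hmem j θ h hn
    rw [h1] at this
    simp at this
  -- integrality
  have hrange_of_root : ∀ z : Λ, ((P i).map g).eval (algebraMap Λ M z) = 0 → algebraMap Λ M z ∈ Set.range g := by
    intro z hz
    have hz' : ((P i).map (algebraMap (PowerSeries Ω) Λ)).eval z = 0 := by
      rw [hg, ← Polynomial.map_map, eval_map_apply] at hz
      exact (map_eq_zero_iff _ (algebraMap Λ M).injective).1 hz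
    have : IsIntegral (PowerSeries Ω) z := by
      obtain ⟨v, hv⟩ := hP i
      refine ⟨C (↑v⁻¹ : PowerSeries Ω) * P i, ?_, ?_⟩
      · apply monic_C_mul_of_mul_leadingCoeff_eq_one
        rw [← hv, Units.inv_mul]
      · rw [eval₂_mul, eval₂_eq_eval_map _ (p := P i), hz', mul_zero]
    obtain ⟨y, hy⟩ := IsIntegrallyClosed.isIntegral_iff.1 this
    exact ⟨y, by rw [hg, RingHom.comp_apply, hy]⟩
  -- some root is not rational
  have hβ : ∃ β, ((P i).map g).eval β = 0 ∧ β ∉ Set.range g := by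
    by_contra! hcon
    have hex : ∃ s : Multiset (PowerSeries Ω), s.map g = ((P i).map g).roots := by
      have hall : ∀ x ∈ ((P i).map g).roots, x ∈ Set.range g := by
        intro x hx
        exact hcon x ((mem_roots (hPg0 i)).1 hx)
      have hcl : CanLift M (PowerSeries Ω) g (fun x => x ∈ Set.range g) := ⟨fun x hx => hx⟩
      exact (Multiset.canLift g (fun x => x ∈ Set.range g)).prf _ hall
    obtain ⟨s, hs'⟩ := hex
    have hfac : P i = C (P i).leadingCoeff * (s.map (fun x => X - C x)).prod := by
      apply map_injective g hginj
      have := (IsAlgClosed.splits ((P i).map g)).eq_prod_roots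
      rw [leadingCoeff_map_of_injective hginj, ← hs'] at this
      conv_lhs => rw [this]
      simp [Polynomial.map_multiset_prod, Multiset.map_map]
    have hred := hi
    rw [hfac, Polynomial.map_mul, Polynomial.map_C, eval_mul, eval_C] at hred
    have hlc : (PowerSeries.constantCoeff (R := Ω)) (P i).leadingCoeff ≠ 0 :=
      ((hP i).map (PowerSeries.constantCoeff (R := Ω))).ne_zero
    have h2 := (mul_eq_zero.1 hred).resolve_left hlc
    rw [Polynomial.map_multiset_prod, eval_multiset_prod, Multiset.prod_eq_zero_iff] at h2
    simp only [Multiset.map_map, Multiset.mem_map, Function.comp_apply] at h2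
    obtain ⟨θ, hθ, h3⟩ := h2
    rw [Polynomial.map_sub, Polynomial.map_X, Polynomial.map_C, eval_sub, eval_X, eval_C,
      sub_eq_zero] at h3
    refine hno θ ?_ h3.symm
    have : g θ ∈ ((P i).map g).roots := by rw [← hs']; exact Multiset.mem_map_of_mem _ hθ
    have := (mem_roots (hPg0 i)).1 this
    rw [IsRoot.def, eval_map_apply] at this
    exact (map_eq_zero_iff g hginj).1 this
  obtain ⟨β, hβ0, hβr⟩ := hβ
  have hβalg : aeval β ((P i).map (algebraMap (PowerSeries Ω) Λ)) = 0 := by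
    rw [aeval_def, eval₂_eq_eval_map, Polynomial.map_map]; exact hβ0
  have hsepβ : IsSeparable Λ β := hsep.of_dvd (minpoly.dvd Λ β hβalg)
  have hnb : β ∉ (⊥ : Subalgebra Λ M) := by
    intro h
    obtain ⟨z, rfl⟩ := Algebra.mem_bot.1 h
    exact hβr (hrange_of_root z hβ0)
  obtain ⟨γ, hne, hconj⟩ := (notMem_iff_exists_ne_and_isConjRoot hsepβ
    (IsAlgClosed.splits _)).1 hnb
  obtain ⟨σ, hσ⟩ := hconj.symm.exists_algEquiv
  have hσroot : ∀ j θ, ((P j).map g).eval θ = 0 → ((P j).map g).eval (σ θ) = 0 := by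
    intro j θ h
    rw [hg, ← Polynomial.map_map, eval_map_algebraMap] at h ⊢
    rw [← AlgEquiv.coe_toAlgHom, aeval_algHom_apply, h, map_zero]
  have hσr : ∀ θ, θ ∈ Set.range g → σ θ = θ := by
    rintro _ ⟨y, rfl⟩
    exact σ.commutes _
  have hσr' : ∀ θ, θ ∉ Set.range g → σ θ ∉ Set.range g := by
    intro θ h h'
    have := hσr _ h'
    rw [σ.injective this] at h'
    exact h h'
  have hγ0 : ((P i).map g).eval γ = 0 := hσ ▸ hσroot i β hβ0
  have hγr : γ ∉ Set.range g := hσ ▸ hσr' β hβr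
  have hset : ∀ θ, ((P i).map g).eval θ = 0 → θ ∉ Set.range g → θ = β ∨ θ = γ := by
    intro θ h1 h2
    by_contra! hcon
    have hsub : ({θ, β, γ} : Finset M) ⊆
        (((P i).map g).roots.toFinset).filter (fun x => x ∉ Set.range g) := by
      intro x hx
      simp only [Finset.mem_insert, Finset.mem_singleton] at hx
      rcases hx with rfl | rfl | rfl
      · exact hmem i _ h1 h2
      · exact hmem i _ hβ0 hβr
      · exact hmem i _ hγ0 hγr
    have h3 := Finset.card_le_card hsub
    rw [Finset.card_eq_three.2 ⟨θ, β, γ, hcon.1, hcon.2, hne, rfl⟩] at h3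
    have := hfew i
    omega
  refine ⟨σ, β, γ, hne, hβ0, hγ0, hσ, ?_, ?_⟩
  · rcases hset (σ γ) (hσroot i γ hγ0) (hσr' γ hγr) with h | h
    · exact h
    · exact absurd (σ.injective (hσ.trans h.symm)) hne
  · intro j θ h h1 h2
    apply hσr
    by_cases hj : j = i
    · subst hj
      by_contra hn
      rcases hset θ h hn with h3 | h3
      · exact h1 h3
      · exact h2 h3
    · exact hrat j hj θ h

end Transposition


section SpecialPoint

variable {k E Ω : Type*} [Field k] [Field E] [Field Ω] [Algebra k E] [Algebra k Ω] [Algebra E Ω]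
  [IsScalarTower k E Ω]

/-- The part of the special polynomial defined over the smaller field. -/
noncomputable def specQ (N : ℕ) (t₀ x₀ x₁ : E) : E[X] :=
  (C x₀ + C x₁ * (X - C t₀)) + (X - C t₀) ^ 2 * (C t₀ * X ^ (N + 1))

/-- The special polynomial. -/
noncomputable def specF (N : ℕ) (t₀ x₀ x₁ : E) (b : Fin 2 → Ω) : Polynomial Ω :=
  (specQ N t₀ x₀ x₁).map (algebraMap E Ω) +
    ((X - C t₀) ^ 2 : E[X]).map (algebraMap E Ω) * (C (b 0) + C (b 1) * X)

theorem specF_eq (N : ℕ) (t₀ x₀ x₁ : E) (b : Fin 2 → Ω) :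
    specF N t₀ x₀ x₁ b = (C x₀ + C x₁ * (X - C t₀) : E[X]).map (algebraMap E Ω) +
      (X - C (algebraMap E Ω t₀)) ^ 2 *
        (C (b 0) + C (b 1) * X + C (algebraMap E Ω t₀) * X ^ (N + 1)) := by
  simp only [specF, specQ, Polynomial.map_add, Polynomial.map_mul, Polynomial.map_pow,
    Polynomial.map_sub, Polynomial.map_X, Polynomial.map_C]
  ring

theorem specF_natDegree (N : ℕ) (t₀ x₀ x₁ : E) (b : Fin 2 → Ω) :
    (specF N t₀ x₀ x₁ b).natDegree ≤ N + 3 := by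
  rw [specF_eq]
  simp only [Polynomial.map_add, Polynomial.map_mul, Polynomial.map_pow,
    Polynomial.map_sub, Polynomial.map_X, Polynomial.map_C]
  refine (natDegree_add_le_of_le (?_ : _ ≤ 1) (?_ : _ ≤ 2 + (N + 1))).trans ?_
  · compute_degree
  · refine natDegree_mul_le_of_le ?_ ?_
    · compute_degree
    · compute_degree
  · simp; omega

theorem specF_coeff (N : ℕ) (t₀ x₀ x₁ : E) (b : Fin 2 → Ω) :
    (specF N t₀ x₀ x₁ b).coeff (N + 3) =
      (if N = 0 then b 1 else 0) + algebraMap E Ω t₀ := by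
  rw [specF_eq]
  have h1 : ((C x₀ + C x₁ * (X - C t₀) : E[X]).map (algebraMap E Ω)).coeff (N + 3) = 0 := by
    apply coeff_eq_zero_of_natDegree_lt
    refine (natDegree_map_le.trans (?_ : _ ≤ 1)).trans_lt (by omega)
    compute_degree
  have e : N + 3 = 2 + (N + 1) := by ring
  have h2 : (X - C (algebraMap E Ω t₀)) ^ 2 = ((X - C (algebraMap E Ω t₀)) ^ 2 : Polynomial Ω) := rfl
  have h3 : ((X - C (algebraMap E Ω t₀)) ^ 2 : Polynomial Ω).coeff 2 = 1 := by
    have hm : ((X - C (algebraMap E Ω t₀)) ^ 2 : Polynomial Ω).Monic := (monic_X_sub_C _).pow 2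
    have hd : ((X - C (algebraMap E Ω t₀)) ^ 2 : Polynomial Ω).natDegree = 2 := by
      rw [natDegree_pow, natDegree_X_sub_C]
    have := hm.coeff_natDegree
    rwa [hd] at this
  rw [coeff_add, h1, zero_add, e, coeff_mul_add_eq_of_natDegree_le, h3, one_mul]
  · simp [coeff_C]
  · compute_degree
  · compute_degree

theorem specF_eval (N : ℕ) (t₀ x₀ x₁ : E) (b : Fin 2 → Ω) :
    (specF N t₀ x₀ x₁ b).eval (algebraMap E Ω t₀) = algebraMap E Ω x₀ := by
  rw [specF_eq]; simp

theorem specF_coeff_transcendental (N : ℕ) (t₀ x₀ x₁ : E) (ht : Transcendental k t₀)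
    {b : Fin 2 → Ω} (hb : AlgebraicIndependent E b) :
    Transcendental k ((specF N t₀ x₀ x₁ b).coeff (N + 3)) := by
  rw [specF_coeff]
  split_ifs with h
  · have hb1 : Transcendental E (b 1) := hb.transcendental 1
    intro halg
    have h1 : IsAlgebraic E (b 1 + algebraMap E Ω t₀) := halg.tower_top E
    apply hb1
    have := h1.sub (isAlgebraic_algebraMap (R := E) (A := Ω) t₀)
    rwa [add_sub_cancel_right] at this
  · rw [zero_add]
    intro halg
    exact ht ((isAlgebraic_algebraMap_iff (algebraMap E Ω).injective).1 halg)

theorem ev2_algebraMap (F : k[X][X]) (τ ξ : E) :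
    ev2 F (algebraMap E Ω τ) (algebraMap E Ω ξ) = algebraMap E Ω (ev2 F τ ξ) :=
  (map_ev2 (IsScalarTower.toAlgHom k E Ω) F τ ξ).symm

theorem spec_rootMultiplicity (N : ℕ) (F : k[X][X]) (t₀ x₀ x₁ : E)
    {b : Fin 2 → Ω} (hb : AlgebraicIndependent E b)
    (h0 : ev2 F t₀ x₀ = 0) (hx : ev2 (derivative F) t₀ x₀ ≠ 0)
    (h1 : (derivative (ev2 F X (C x₀))).eval t₀ + ev2 (derivative F) t₀ x₀ * x₁ = 0)
    (hne : ev2 F X (specF N t₀ x₀ x₁ b) ≠ 0) :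
    (ev2 F X (specF N t₀ x₀ x₁ b)).rootMultiplicity (algebraMap E Ω t₀) ≤ 2 := by
  by_contra hcon
  have hdvd := (le_rootMultiplicity_iff hne (a := algebraMap E Ω t₀) (n := 3)).1 (by omega)
  set ℓ : E[X] := C x₀ + C x₁ * (X - C t₀) with hℓ
  have hℓe : ℓ.eval t₀ = x₀ := by simp [hℓ]
  have hℓ2 : (X - C t₀) ^ 2 ∣ ev2 F X ℓ := by
    by_cases hz : ev2 F X ℓ = 0
    · rw [hz]; exact dvd_zero _
    rw [← le_rootMultiplicity_iff hz]
    refine (one_lt_rootMultiplicity_iff_isRoot hz).2 ⟨?_, ?_⟩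
    · rw [IsRoot.def, eval_ev2, hℓe, h0]
    · rw [IsRoot.def, derivative_ev2, hℓe, ← h1]
      simp [hℓ]
  obtain ⟨Q, hQ⟩ := hℓ2
  set g : Polynomial Ω := C (b 0) + C (b 1) * X + C (algebraMap E Ω t₀) * X ^ (N + 1) with hg
  set y : Polynomial Ω := X - C (algebraMap E Ω t₀) with hy
  have hspec : specF N t₀ x₀ x₁ b = ℓ.map (algebraMap E Ω) + y ^ 2 * g := specF_eq N t₀ x₀ x₁ b
  obtain ⟨c, hc⟩ := ev2_add F X (ℓ.map (algebraMap E Ω)) (y ^ 2 * g)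
  have hmap : ev2 F X (ℓ.map (algebraMap E Ω)) = y ^ 2 * Q.map (algebraMap E Ω) := by
    have := mapPoly_ev2 (IsScalarTower.toAlgHom k E Ω) F ℓ
    rw [hQ] at this
    simp only [Polynomial.map_mul, Polynomial.map_pow, Polynomial.map_sub, Polynomial.map_X,
      Polynomial.map_C] at this
    exact this.symm
  rw [hspec, hc, hmap] at hdvd
  have e : y ^ 2 * Q.map (algebraMap E Ω) + ev2 (derivative F) X (ℓ.map (algebraMap E Ω)) * (y ^ 2 * g) +
      c * (y ^ 2 * g) ^ 2 = y ^ 2 * (Q.map (algebraMap E Ω) +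
        ev2 (derivative F) X (ℓ.map (algebraMap E Ω)) * g + c * y ^ 2 * g ^ 2) := by ring
  have hy0 : y ^ 2 ≠ 0 := pow_ne_zero _ (X_sub_C_ne_zero _)
  rw [e, pow_succ, mul_dvd_mul_iff_left hy0] at hdvd
  have hroot := dvd_iff_isRoot.1 hdvd
  have hye : y.eval (algebraMap E Ω t₀) = 0 := by simp [hy]
  rw [IsRoot.def, eval_add, eval_add, eval_mul, eval_mul, eval_mul, eval_pow, hye, eval_ev2,
    eval_map_apply, eval_map_apply, hℓe, ev2_algebraMap] at hroot
  have hge : g.eval (algebraMap E Ω t₀) = b 0 + b 1 * algebraMap E Ω t₀ +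
      algebraMap E Ω t₀ * algebraMap E Ω t₀ ^ (N + 1) := by simp [hg]
  rw [hge] at hroot
  have hx' : algebraMap E Ω (ev2 (derivative F) t₀ x₀) ≠ 0 := by simpa using hx
  have hb0 : b 0 = - algebraMap E Ω (Q.eval t₀) / algebraMap E Ω (ev2 (derivative F) t₀ x₀) -
      b 1 * algebraMap E Ω t₀ - algebraMap E Ω t₀ * algebraMap E Ω t₀ ^ (N + 1) := by
    field_simp
    linear_combination hroot
  apply not_both_mem_algOver hb (b 1)
  have hm : ∀ z : E, algebraMap E Ω z ∈ algOver E (b 1) := fun z => algebraMap_mem _ z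
  refine ⟨?_, self_mem_algOver _⟩
  rw [hb0]
  exact sub_mem (sub_mem (div_mem (neg_mem (hm _)) (hm _)) (mul_mem (self_mem_algOver _) (hm _)))
    (mul_mem (hm _) (pow_mem (hm _) _))

end SpecialPoint


section PowerSeriesDeformation

variable {k Ω : Type*} [Field k] [Field Ω] [Algebra k Ω]

/-- The constant coefficient as an algebra homomorphism. -/
noncomputable def ccHom (k Ω : Type*) [Field k] [Field Ω] [Algebra k Ω] :
    PowerSeries Ω →ₐ[k] Ω :=
  { (PowerSeries.constantCoeff (R := Ω)) with
    commutes' := fun r => by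
      change PowerSeries.constantCoeff (algebraMap k (PowerSeries Ω) r) = _
      rw [PowerSeries.algebraMap_apply, PowerSeries.constantCoeff_C] }

theorem ccHom_coe : (ccHom k Ω : PowerSeries Ω →+* Ω) = PowerSeries.constantCoeff := rfl

theorem ccHom_apply (z : PowerSeries Ω) : ccHom k Ω z = PowerSeries.constantCoeff z := rfl

/-- Constants as an algebra homomorphism. -/
noncomputable def CHom (k Ω : Type*) [Field k] [Field Ω] [Algebra k Ω] :
    Ω →ₐ[k] PowerSeries Ω :=
  { (PowerSeries.C (R := Ω)) with
    commutes' := fun r => by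
      change PowerSeries.C (algebraMap k Ω r) = _
      rw [PowerSeries.algebraMap_apply] }

theorem CHom_coe : (CHom k Ω : Ω →+* PowerSeries Ω) = PowerSeries.C := rfl

theorem CHom_apply (z : Ω) : CHom k Ω z = PowerSeries.C z := rfl

/-- The deformation `f + u v`. -/
noncomputable def deform (f v : Polynomial Ω) : Polynomial (PowerSeries Ω) :=
  f.map PowerSeries.C + C PowerSeries.X * v.map PowerSeries.C

theorem deform_map (f v : Polynomial Ω) : (deform f v).map PowerSeries.constantCoeff = f := by
  simp [deform, Polynomial.map_map]

theorem deform_natDegree (n : ℕ) (f v : Polynomial Ω) (hf : f.natDegree ≤ n) (hv : v.natDegree ≤ n) :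
    (deform f v).natDegree ≤ n := by
  refine natDegree_add_le_of_degree_le (natDegree_map_le.trans hf) ?_
  exact (natDegree_C_mul_le _ _).trans (natDegree_map_le.trans hv)

theorem ev2_deform_map (F : k[X][X]) (f v : Polynomial Ω) :
    (ev2 F X (deform f v)).map PowerSeries.constantCoeff = ev2 F X f := by
  have := mapPoly_ev2 (ccHom k Ω) F (deform f v)
  rwa [ccHom_coe, deform_map] at this

theorem ev2_deform_unit (F : k[X][X]) (hmon : F.Monic) (n : ℕ) (f v : Polynomial Ω)
    (hf : f.natDegree ≤ n) (hv : v.natDegree ≤ n)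
    (hF : ∀ j ≤ F.natDegree, (F.coeff j).natDegree ≤ (F.natDegree - j) * n)
    (ht : Transcendental k (f.coeff n)) :
    IsUnit (ev2 F X (deform f v)).leadingCoeff := by
  have hdeg := natDegree_ev2_le F n (deform f v) (deform_natDegree n f v hf hv) hF
  have hu : IsUnit ((ev2 F X (deform f v)).coeff (F.natDegree * n)) := by
    rw [PowerSeries.isUnit_iff_constantCoeff, isUnit_iff_ne_zero, ← coeff_map, ev2_deform_map,
      coeff_ev2 F n f hf hF]
    exact leadingCoeff_ev2_ne_zero F hmon n f ht
  have : (ev2 F X (deform f v)).natDegree = F.natDegree * n :=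
    le_antisymm hdeg (le_natDegree_of_ne_zero hu.ne_zero)
  rwa [leadingCoeff, this]

theorem no_root_over (F : k[X][X]) (t₀ x₀ x₁ : Ω) (g v : Polynomial Ω)
    (h0 : ev2 F t₀ x₀ = 0) (hx : ev2 (derivative F) t₀ x₀ ≠ 0)
    (h1 : (derivative (ev2 F X (C x₀))).eval t₀ + ev2 (derivative F) t₀ x₀ * x₁ = 0)
    (hv : v.eval t₀ ≠ 0) (θ : PowerSeries Ω)
    (hθ : (ev2 F X (deform (C x₀ + C x₁ * (X - C t₀) + (X - C t₀) ^ 2 * g) v)).eval θ = 0) :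
    PowerSeries.constantCoeff θ ≠ t₀ := by
  intro hcc
  obtain ⟨z, hz⟩ : PowerSeries.X ∣ θ - PowerSeries.C t₀ := by
    rw [PowerSeries.X_dvd_iff]; simp [hcc]
  have hθz : θ = PowerSeries.C t₀ + PowerSeries.X * z := by rw [← hz]; ring
  set G : PowerSeries Ω := (g.map PowerSeries.C).eval θ with hG
  set V : PowerSeries Ω := (v.map PowerSeries.C).eval θ with hV
  have hfe : (deform (C x₀ + C x₁ * (X - C t₀) + (X - C t₀) ^ 2 * g) v).eval θ =
      PowerSeries.C x₀ + PowerSeries.X * (PowerSeries.C x₁ * z + V + PowerSeries.X * z ^ 2 * G) := by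
    have : θ - PowerSeries.C t₀ = PowerSeries.X * z := hz
    simp only [deform, Polynomial.map_add, Polynomial.map_mul, Polynomial.map_pow,
      Polynomial.map_sub, Polynomial.map_X, Polynomial.map_C, eval_add, eval_mul, eval_pow,
      eval_sub, eval_X, eval_C, ← hG, ← hV, this]
    ring
  rw [eval_ev2, hfe] at hθ
  obtain ⟨c, hc⟩ := ev2_add F θ (PowerSeries.C x₀)
    (PowerSeries.X * (PowerSeries.C x₁ * z + V + PowerSeries.X * z ^ 2 * G))
  rw [hc] at hθ
  have hp : ev2 F θ (PowerSeries.C x₀) =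
      ((ev2 F X (C x₀)).map PowerSeries.C).eval θ := by
    have := mapPoly_ev2 (CHom k Ω) F (C x₀)
    rw [CHom_coe] at this
    rw [this, eval_ev2]
    simp
  obtain ⟨c', hc'⟩ := binomExpansion ((ev2 F X (C x₀)).map PowerSeries.C) (PowerSeries.C t₀)
    (PowerSeries.X * z)
  rw [← hθz, ← hp, derivative_map, eval_map_apply, eval_map_apply, eval_ev2, eval_C, h0, map_zero,
    zero_add] at hc'
  rw [hc'] at hθ
  have e : PowerSeries.X * (PowerSeries.C (eval t₀ (derivative (ev2 F X (C x₀)))) * z +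
      c' * PowerSeries.X * z ^ 2 + ev2 (derivative F) θ (PowerSeries.C x₀) *
        (PowerSeries.C x₁ * z + V + PowerSeries.X * z ^ 2 * G) +
      c * PowerSeries.X * (PowerSeries.C x₁ * z + V + PowerSeries.X * z ^ 2 * G) ^ 2) = 0 := by
    rw [← hθ]; ring
  have e2 := (mul_eq_zero.1 e).resolve_left PowerSeries.X_ne_zero
  have e3 := congrArg (ccHom k Ω) e2
  have hXc : ccHom k Ω PowerSeries.X = 0 := by simp [ccHom_apply]
  have hCc : ∀ a, ccHom k Ω (PowerSeries.C a) = a := by simp [ccHom_apply]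
  have hVc : ccHom k Ω V = v.eval t₀ := by
    have := eval_map_apply (f := PowerSeries.constantCoeff (R := Ω)) (p := v.map PowerSeries.C) θ
    rw [ccHom_apply, hV, ← this, hcc, Polynomial.map_map]
    simp
  simp only [map_add, map_mul, map_pow, hXc, hCc, hVc, map_ev2, map_zero] at e3
  rw [ccHom_apply θ, hcc] at e3
  have : ev2 (derivative F) t₀ x₀ * v.eval t₀ = 0 := by
    linear_combination e3 - (ccHom k Ω z) * h1
  exact (mul_ne_zero hx hv) this

end PowerSeriesDeformation


section Special

theorem ev2_eval_product_simple {k Ω : Type*} [Field k] [Field Ω] [Algebra k Ω]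
    (F G : k[X][X]) (hFG : F ∣ G) (f : Polynomial Ω) (τ : Ω)
    (h : (ev2 G X f).eval τ = 0 → (derivative (ev2 G X f)).eval τ ≠ 0)
    (h0 : (ev2 F X f).eval τ = 0) : (derivative (ev2 F X f)).eval τ ≠ 0 := by
  obtain ⟨H, rfl⟩ := hFG
  intro h1
  rw [ev2_mul] at h
  apply h
  · simp [h0]
  · simp [h0, h1]

theorem exists_special_point {k : Type u} [Field k] (F : k[X][X]) (hmon : F.Monic)
    (hdeg : 0 < F.natDegree) :
    ∃ (E : Type u) (_ : Field E) (_ : Algebra k E) (t₀ x₀ : E), Transcendental k t₀ ∧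
      ev2 F t₀ x₀ = 0 := by
  let E := AlgebraicClosure (FractionRing k[X])
  have hinj : Function.Injective (algebraMap k[X] E) := by
    rw [IsScalarTower.algebraMap_eq k[X] (FractionRing k[X]) E]
    exact (algebraMap (FractionRing k[X]) E).injective.comp (IsFractionRing.injective _ _)
  have ht : Transcendental k (algebraMap k[X] E X) := by
    intro h
    exact transcendental_X k ((isAlgebraic_algebraMap_iff hinj).1 h)
  have hmon' := hmon.map ((aeval (algebraMap k[X] E X) : k[X] →ₐ[k] E) : k[X] →+* E)
  obtain ⟨x, hx⟩ := IsAlgClosed.exists_root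
    (F.map ((aeval (algebraMap k[X] E X) : k[X] →ₐ[k] E) : k[X] →+* E)) (by
      rw [hmon.degree_map]
      exact (natDegree_pos_iff_degree_pos.1 hdeg).ne')
  refine ⟨E, inferInstance, inferInstance, algebraMap k[X] E X, x, ht, ?_⟩
  rw [ev2_eq_eval]
  exact hx

theorem exists_generic_field (E : Type u) [Field E] (n : ℕ) :
    ∃ (Ω : Type u) (_ : Field Ω) (_ : IsAlgClosed Ω) (_ : Algebra E Ω) (w : Fin n → Ω),
      AlgebraicIndependent E w := by
  have h : ∀ (K : Type u) [Field K] [Algebra E K] (w : Fin n → K), AlgebraicIndependent E w →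
      ∃ (Ω : Type u) (_ : Field Ω) (_ : IsAlgClosed Ω) (_ : Algebra E Ω) (w : Fin n → Ω),
      AlgebraicIndependent E w := by
    intro K _ _ w hw
    have h2 := hw.map' (f := IsScalarTower.toAlgHom E K (AlgebraicClosure K))
      (algebraMap K (AlgebraicClosure K)).injective
    exact ⟨AlgebraicClosure K, inferInstance, inferInstance, inferInstance, _, h2⟩
  have h1 := (MvPolynomial.algebraicIndependent_X (Fin n) E).map'
    (f := IsScalarTower.toAlgHom E (MvPolynomial (Fin n) E) (FractionRing (MvPolynomial (Fin n) E)))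
    (IsFractionRing.injective _ _)
  exact h _ _ h1

theorem exists_special {k : Type u} [Field k] {ι : Type*} [Fintype ι] (N : ℕ)
    (F : ι → k[X][X]) (hmon : ∀ j, (F j).Monic)
    (hF : ∀ i, ∀ j ≤ (F i).natDegree,
      ((F i).coeff j).natDegree ≤ ((F i).natDegree - j) * (N + 3))
    (hsep : ((∏ j, F j).map (algebraMap k[X] (FractionRing k[X]))).Separable)
    (i : ι) (hdeg : 0 < (F i).natDegree)
    (f : Polynomial (MvPolynomial (Fin (N + 3 + 1)) k))
    (hf : f = ∑ j : Fin (N + 3 + 1), C (MvPolynomial.X j) * X ^ (j : ℕ)) :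
    ∃ (Ω : Type u) (_ : Field Ω) (_ : IsAlgClosed Ω) (_ : Algebra k Ω)
      (φ : MvPolynomial (Fin (N + 3 + 1)) k →ₐ[k] PowerSeries Ω) (t₀ : Ω),
      Function.Injective φ ∧
      ∀ P : ι → Polynomial (PowerSeries Ω),
      (∀ j, P j = ev2 (F j) X (f.map (φ : _ →+* PowerSeries Ω))) →
      (∀ j, IsUnit (P j).leadingCoeff) ∧
      (∀ j a, a ≠ t₀ → ((P j).map PowerSeries.constantCoeff).eval a = 0 →
        (derivative ((P j).map PowerSeries.constantCoeff)).eval a ≠ 0) ∧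
      (∀ j, j ≠ i → ((P j).map PowerSeries.constantCoeff).eval t₀ ≠ 0) ∧
      ((P i).map PowerSeries.constantCoeff).eval t₀ = 0 ∧
      ((P i).map PowerSeries.constantCoeff).rootMultiplicity t₀ ≤ 2 ∧
      (∀ θ, (P i).eval θ = 0 → PowerSeries.constantCoeff θ ≠ t₀) := by
  classical
  obtain ⟨E, _, _, t₀, x₀, ht, h0⟩ := exists_special_point (F i) (hmon i) hdeg
  obtain ⟨Ω, _, _, _, w, hw⟩ := exists_generic_field E (N + 3 + 1)
  let _ : Algebra k Ω := ((algebraMap E Ω).comp (algebraMap k E)).toAlgebra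
  have : IsScalarTower k E Ω := IsScalarTower.of_algebraMap_eq fun _ => rfl
  set b : Fin 2 → Ω := fun j => w (Fin.castLE (by omega) j) with hbdef
  have hb : AlgebraicIndependent E b := hw.comp _ (Fin.castLE_injective _)
  -- nonvanishing
  have hGx : ∀ j, j ≠ i → ev2 (F j) t₀ x₀ ≠ 0 := by
    intro j hj hj0
    refine ev2_derivative_ne_zero _ hsep ht (ξ := x₀) ?_ ?_
    · rw [ev2_prod]; exact Finset.prod_eq_zero (Finset.mem_univ i) h0
    · rw [← Finset.mul_prod_erase _ _ (Finset.mem_univ i), derivative_mul]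
      have hz : ev2 (∏ l ∈ Finset.univ.erase i, F l) t₀ x₀ = 0 := by
        rw [ev2_prod]
        exact Finset.prod_eq_zero (Finset.mem_erase.2 ⟨hj, Finset.mem_univ j⟩) hj0
      rw [ev2, eval₂_add, ← ev2, ← ev2, ev2_mul, ev2_mul, h0, hz]
      simp
  have hx : ev2 (derivative (F i)) t₀ x₀ ≠ 0 := by
    intro hx
    refine ev2_derivative_ne_zero _ hsep ht (ξ := x₀) ?_ ?_
    · rw [ev2_prod]; exact Finset.prod_eq_zero (Finset.mem_univ i) h0
    · rw [← Finset.mul_prod_erase _ _ (Finset.mem_univ i), derivative_mul]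
      rw [ev2, eval₂_add, ← ev2, ← ev2, ev2_mul, ev2_mul, h0, hx]
      simp
  set x₁ : E := -(derivative (ev2 (F i) X (C x₀))).eval t₀ / ev2 (derivative (F i)) t₀ x₀ with hx₁
  have h1 : (derivative (ev2 (F i) X (C x₀))).eval t₀ + ev2 (derivative (F i)) t₀ x₀ * x₁ = 0 := by
    rw [hx₁]; field_simp; ring
  set f₀ : Polynomial Ω := specF N t₀ x₀ x₁ b with hf₀
  set W : Polynomial Ω := ∑ j : Fin (N + 3 + 1), C (w j) * X ^ (j : ℕ) with hW
  have hWdeg : W.natDegree ≤ N + 3 := by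
    refine natDegree_sum_le_of_forall_le _ _ fun j _ => ?_
    exact (natDegree_C_mul_X_pow_le _ _).trans (by omega)
  have hWc : ∀ j : Fin (N + 3 + 1), W.coeff j = w j := by
    intro j
    rw [hW, finsetSum_coeff, Finset.sum_eq_single j]
    · simp
    · intro l _ hl
      have : (j : ℕ) ≠ l := fun h => hl (Fin.ext h.symm)
      simp [coeff_X_pow, this]
    · simp
  have hf₀deg : f₀.natDegree ≤ N + 3 := specF_natDegree _ _ _ _ _
  set v : Polynomial Ω := W - f₀ with hv
  have hvdeg : v.natDegree ≤ N + 3 := (natDegree_sub_le_of_le hWdeg hf₀deg).trans (by simp)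
  have htop : Transcendental k (f₀.coeff (N + 3)) := specF_coeff_transcendental N t₀ x₀ x₁ ht hb
  let φ : MvPolynomial (Fin (N + 3 + 1)) k →ₐ[k] PowerSeries Ω :=
    MvPolynomial.aeval fun j => PowerSeries.C (f₀.coeff j) + PowerSeries.X * PowerSeries.C (v.coeff j)
  have hfφ : f.map (φ : _ →+* PowerSeries Ω) = deform f₀ v := by
    ext1 l
    by_cases hl : l < N + 3 + 1
    · have e1 : f.coeff l = MvPolynomial.X (⟨l, hl⟩ : Fin (N + 3 + 1)) := by
        rw [hf, finsetSum_coeff, Finset.sum_eq_single (⟨l, hl⟩ : Fin (N + 3 + 1))]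
        · simp
        · intro j _ hj
          have : l ≠ j := fun h => hj (Fin.ext h.symm)
          simp [coeff_X_pow, this]
        · simp
      rw [coeff_map, e1]
      simp [φ, deform]
    · have hfd : f.natDegree ≤ N + 3 := by
        rw [hf]
        refine natDegree_sum_le_of_forall_le _ _ fun j _ => ?_
        exact (natDegree_C_mul_X_pow_le _ _).trans (by omega)
      rw [coeff_map, coeff_eq_zero_of_natDegree_lt (by omega), map_zero,
        coeff_eq_zero_of_natDegree_lt]
      exact (deform_natDegree (N + 3) f₀ v hf₀deg hvdeg).trans_lt (by omega)
  have hφinj : Function.Injective φ := by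
    let ψ : MvPolynomial (Fin (N + 3 + 1)) k →ₐ[k] Polynomial Ω :=
      MvPolynomial.aeval fun j => C (f₀.coeff j) + X * C (v.coeff j)
    have hψφ : ∀ z, φ z = ((ψ z : Polynomial Ω) : PowerSeries Ω) := by
      intro z
      have : φ = ((Polynomial.coeToPowerSeries.algHom (R := Ω) Ω).restrictScalars k).comp ψ := by
        apply MvPolynomial.algHom_ext
        intro j
        simp [φ, ψ]
        ring
      rw [this]
      simp
    have hψw : ∀ z, (ψ z).eval 1 = MvPolynomial.aeval w z := by
      intro z
      have : ((aeval (1 : Ω) : Polynomial Ω →ₐ[Ω] Ω).restrictScalars k).comp ψ =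
          MvPolynomial.aeval w := by
        apply MvPolynomial.algHom_ext
        intro j
        simp [ψ, hv, hWc]
      rw [← this]
      simp [coe_aeval_eq_eval]
    have hwk : AlgebraicIndependent k w :=
      hw.restrictScalars (algebraMap k E).injective
    intro z z' h
    rw [hψφ, hψφ] at h
    have h2 := Polynomial.coe_injective Ω h
    apply hwk
    change MvPolynomial.aeval w z = MvPolynomial.aeval w z'
    rw [← hψw, ← hψw, h2]
  refine ⟨Ω, inferInstance, inferInstance, inferInstance, φ, algebraMap E Ω t₀, hφinj, ?_⟩
  intro P hP
  have hP' : ∀ j, P j = ev2 (F j) X (deform f₀ v) := by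
    intro j; rw [hP, hfφ]
  have hPm : ∀ j, (P j).map PowerSeries.constantCoeff = ev2 (F j) X f₀ := by
    intro j; rw [hP', ev2_deform_map]
  have hev : ∀ j, (ev2 (F j) X f₀).eval (algebraMap E Ω t₀) = algebraMap E Ω (ev2 (F j) t₀ x₀) := by
    intro j
    rw [eval_ev2, hf₀, specF_eval, ev2_algebraMap]
  refine ⟨?_, ?_, ?_, ?_, ?_, ?_⟩
  · intro j
    rw [hP']
    exact ev2_deform_unit (F j) (hmon j) (N + 3) f₀ v hf₀deg hvdeg (hF j) htop
  · intro j a ha hroot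
    rw [hPm] at hroot ⊢
    refine ev2_eval_product_simple (F j) (∏ j, F j) (Finset.dvd_prod_of_mem F (Finset.mem_univ j))
      f₀ a ?_ hroot
    refine simple_roots (∏ j, F j) (monic_prod_of_monic _ _ fun j _ => hmon j) hsep hb
      (specQ N t₀ x₀ x₁) ((X - C t₀) ^ 2) f₀ rfl a ?_
    simpa [sub_eq_zero] using ha
  · intro j hj
    rw [hPm, hev]
    simpa using hGx j hj
  · rw [hPm, hev, h0, map_zero]
  · rw [hPm]
    refine spec_rootMultiplicity N (F i) t₀ x₀ x₁ hb h0 hx h1 ?_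
    intro hz
    have h2 := coeff_ev2 (F i) (N + 3) f₀ hf₀deg (hF i)
    rw [hz] at h2
    exact leadingCoeff_ev2_ne_zero (F i) (hmon i) (N + 3) f₀ htop h2.symm
  · intro θ hθ
    rw [hP', hf₀, specF_eq] at hθ
    simp only [Polynomial.map_add, Polynomial.map_mul, Polynomial.map_sub, Polynomial.map_X,
      Polynomial.map_C] at hθ
    refine no_root_over (F i) _ _ _ _ v ?_ ?_ ?_ ?_ θ hθ
    · rw [ev2_algebraMap, h0, map_zero]
    · rw [ev2_algebraMap]; simpa using hx
    · have := congrArg (algebraMap E Ω) h1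
      have e : ev2 (F i) X (C (algebraMap E Ω x₀)) =
          (ev2 (F i) X (C x₀)).map (algebraMap E Ω) := by
        have := mapPoly_ev2 (IsScalarTower.toAlgHom k E Ω) (F i) (C x₀)
        rw [Polynomial.map_C] at this
        exact this.symm
      rw [e, derivative_map, eval_map_apply, ev2_algebraMap, ← map_mul, ← map_add, h1, map_zero]
    · rw [hv, eval_sub, hf₀, specF_eval, hW, eval_finsetSum]
      intro hz
      have hz2 : MvPolynomial.aeval w (∑ j : Fin (N + 3 + 1), MvPolynomial.X j *
          MvPolynomial.C (t₀ ^ (j : ℕ)) - MvPolynomial.C x₀) = 0 := by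
        rw [← hz]
        simp
      have hz3 := (algebraicIndependent_iff.1 hw) _ hz2
      have hz4 := congrArg (MvPolynomial.aeval (fun j : Fin (N + 3 + 1) => if j = 0 then x₀ + 1 else 0)) hz3
      simp at hz4

end Special


section Hypotheses

theorem separable_map_of_irreducible {k : Type*} [Field k] (p : ℕ) [hp : Fact p.Prime] [CharP k p]
    (F : k[X][X]) (hmon : F.Monic) (hirr : Irreducible F) (hsep : ∀ G : k[X][X], F ≠ G.comp (X ^ p)) :
    (F.map (algebraMap k[X] (FractionRing k[X]))).Separable := by
  have hirr' : Irreducible (F.map (algebraMap k[X] (FractionRing k[X]))) :=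
    (hmon.irreducible_iff_irreducible_map_fraction_map).1 hirr
  rw [separable_iff_derivative_ne_zero hirr', derivative_map,
    Polynomial.map_ne_zero_iff (IsFractionRing.injective _ _)]
  intro h
  refine hsep (contract p F) ?_
  rw [← expand_eq_comp_X_pow, expand_contract p h hp.out.ne_zero]

theorem isCoprime_map_of_irreducible {A K : Type*} [CommRing A] [IsDomain A] [IsIntegrallyClosed A]
    [Field K] [Algebra A K] [IsFractionRing A K]
    (F G : A[X]) (hF : F.Monic) (hG : G.Monic) (hFi : Irreducible F) (hGi : Irreducible G)
    (h : ¬ Associated F G) :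
    IsCoprime (F.map (algebraMap A K)) (G.map (algebraMap A K)) := by
  have hFi' : Irreducible (F.map (algebraMap A K)) :=
    (hF.irreducible_iff_irreducible_map_fraction_map).1 hFi
  rw [hFi'.coprime_iff_not_dvd]
  intro hd
  apply h
  exact hFi.associated_of_dvd hGi (Monic.dvd_of_fraction_map_dvd_fraction_map hG hF hd)

end Hypotheses

section Descend

variable {K L Λ M ι : Type*} [Field K] [Field L] [Field Λ] [Field M] [Algebra K L] [Algebra K Λ]
  [Algebra Λ M] [Algebra K M] [IsScalarTower K Λ M]

theorem descend_transposition [IsAlgClosed M] [Fintype ι] (P : ι → K[X])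
    [hL : IsSplittingField K L (∏ j, P j)] (h0 : ∀ j, P j ≠ 0) (i : ι)
    (σ : M ≃ₐ[Λ] M) (β γ : M) (hne : β ≠ γ)
    (hβ : aeval β (P i) = 0) (hγ : aeval γ (P i) = 0) (h1 : σ β = γ) (h2 : σ γ = β)
    (h3 : ∀ j θ, aeval θ (P j) = 0 → θ ≠ β → θ ≠ γ → σ θ = θ) :
    ∃ (σ : L ≃ₐ[K] L) (β γ : L), β ≠ γ ∧ aeval β (P i) = 0 ∧ aeval γ (P i) = 0 ∧ σ β = γ ∧ σ γ = β ∧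
      ∀ j θ, aeval θ (P j) = 0 → θ ≠ β → θ ≠ γ → σ θ = θ := by
  classical
  let J : L →ₐ[K] M := IsSplittingField.lift L (∏ j, P j) (IsAlgClosed.splits _)
  let _ : Algebra L M := (J : L →+* M).toAlgebra
  have hJ : ∀ x, algebraMap L M x = J x := fun _ => rfl
  have : IsScalarTower K L M := IsScalarTower.of_algebraMap_eq fun x => (J.commutes x).symm
  have hnorm : Normal K L := Normal.of_isSplittingField (∏ j, P j)
  have hsplit : ∀ j, ((P j).map (algebraMap K L)).Splits := by
    intro j
    refine (IsSplittingField.splits L (∏ j, P j)).of_dvd ?_ ?_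
    · exact (Polynomial.map_ne_zero_iff (algebraMap K L).injective).2
        (Finset.prod_ne_zero_iff.2 fun j _ => h0 j)
    · exact Polynomial.map_dvd _ (Finset.dvd_prod_of_mem P (Finset.mem_univ j))
  have hlift : ∀ j θ, aeval θ (P j) = 0 → ∃ θ' : L, algebraMap L M θ' = θ := by
    intro j θ hθ
    have hr : θ ∈ ((P j).map (algebraMap K M)).roots := by
      rw [mem_roots ((Polynomial.map_ne_zero_iff (algebraMap K M).injective).2 (h0 j)), IsRoot.def,
        eval_map_algebraMap]
      exact hθ
    rw [IsScalarTower.algebraMap_eq K L M, ← Polynomial.map_map, (hsplit j).roots_map] at hr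
    obtain ⟨θ', _, h⟩ := Multiset.mem_map.1 hr
    exact ⟨θ', h⟩
  have haev : ∀ j (θ : L), aeval (algebraMap L M θ) (P j) = 0 ↔ aeval θ (P j) = 0 := by
    intro j θ
    rw [aeval_algebraMap_apply]
    exact map_eq_zero_iff _ (algebraMap L M).injective
  obtain ⟨β', rfl⟩ := hlift i β hβ
  obtain ⟨γ', rfl⟩ := hlift i γ hγ
  let σK : M ≃ₐ[K] M := σ.restrictScalars K
  have hr : ∀ x : L, algebraMap L M (σK.restrictNormal L x) = σ (algebraMap L M x) :=
    fun x => AlgEquiv.restrictNormal_commutes σK L x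
  have hinj := (algebraMap L M).injective
  refine ⟨σK.restrictNormal L, β', γ', fun h => hne (by rw [h]), (haev i _).1 hβ, (haev i _).1 hγ,
    hinj ?_, hinj ?_, ?_⟩
  · rw [hr, h1]
  · rw [hr, h2]
  · intro j θ hθ hθ1 hθ2
    apply hinj
    rw [hr]
    exact h3 j _ ((haev j θ).2 hθ) (fun h => hθ1 (hinj h)) (fun h => hθ2 (hinj h))

theorem all_transpositions (P : ι → K[X]) (i : ι)
    (hT : ∃ (σ : L ≃ₐ[K] L) (β γ : L), β ≠ γ ∧ aeval β (P i) = 0 ∧ aeval γ (P i) = 0 ∧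
      σ β = γ ∧ σ γ = β ∧ ∀ j θ, aeval θ (P j) = 0 → θ ≠ β → θ ≠ γ → σ θ = θ)
    (h2 : ∀ β γ β' γ' : L, β ≠ γ → β' ≠ γ' → aeval β (P i) = 0 → aeval γ (P i) = 0 →
      aeval β' (P i) = 0 → aeval γ' (P i) = 0 → ∃ σ : L ≃ₐ[K] L, σ β = β' ∧ σ γ = γ')
    (β γ : L) (hne : β ≠ γ) (hβ : aeval β (P i) = 0) (hγ : aeval γ (P i) = 0) :
    ∃ σ : L ≃ₐ[K] L, σ β = γ ∧ σ γ = β ∧ ∀ j θ, aeval θ (P j) = 0 → θ ≠ β → θ ≠ γ → σ θ = θ := by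
  obtain ⟨τ, β₀, γ₀, hne₀, hβ₀, hγ₀, e1, e2, e3⟩ := hT
  obtain ⟨ρ, r1, r2⟩ := h2 β γ β₀ γ₀ hne hne₀ hβ hγ hβ₀ hγ₀
  refine ⟨(ρ.trans τ).trans ρ.symm, ?_, ?_, ?_⟩
  · simp [r1, e1, ← r2]
  · simp [r2, e2, ← r1]
  · intro j θ hθ h1 h2
    have : τ (ρ θ) = ρ θ := by
      refine e3 j _ ?_ ?_ ?_
      · rw [← AlgEquiv.coe_toAlgHom, aeval_algHom_apply, hθ, map_zero]
      · rw [← r1]; exact fun h => h1 (ρ.injective h)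
      · rw [← r2]; exact fun h => h2 (ρ.injective h)
    simp [this]

theorem realize_all {m : ℕ} (P : Fin m → K[X]) (N : Fin m → ℕ)
    [hL : IsSplittingField K L (∏ j, P j)] (h0 : ∀ j, P j ≠ 0)
    (hdis : ∀ i j, i ≠ j → ∀ x : L, aeval x (P i) = 0 → aeval x (P j) ≠ 0)
    (hT : ∀ i, ∀ β γ : L, β ≠ γ → aeval β (P i) = 0 → aeval γ (P i) = 0 →
      ∃ σ : L ≃ₐ[K] L, σ β = γ ∧ σ γ = β ∧ ∀ j θ, aeval θ (P j) = 0 → θ ≠ β → θ ≠ γ → σ θ = θ)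
    (r : ∀ i, Fin (N i) ≃ (P i).rootSet L) (π : ∀ i, Equiv.Perm (Fin (N i))) :
    ∃! σ : L ≃ₐ[K] L, ∀ i a, σ (r i a : L) = (r i (π i a) : L) := by
  classical
  have hr0 : ∀ i a, aeval (r i a : L) (P i) = 0 := fun i a => (mem_rootSet.1 (r i a).2).2
  let H : Subgroup (∀ i, Equiv.Perm (Fin (N i))) :=
    { carrier := {π | ∃ σ : L ≃ₐ[K] L, ∀ i a, σ (r i a : L) = (r i (π i a) : L)}
      one_mem' := ⟨1, fun i a => rfl⟩
      mul_mem' := by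
        rintro π π' ⟨σ, hσ⟩ ⟨σ', hσ'⟩
        refine ⟨σ * σ', fun i a => ?_⟩
        rw [AlgEquiv.mul_apply, hσ', hσ]; rfl
      inv_mem' := by
        rintro π ⟨σ, hσ⟩
        refine ⟨σ⁻¹, fun i a => ?_⟩
        have := hσ i ((π i)⁻¹ a)
        have e : π i ((π i)⁻¹ a) = a := (π i).apply_symm_apply a
        rw [e] at this
        rw [← this]
        exact σ.symm_apply_apply _ }
  have hswap : ∀ i (a b : Fin (N i)), Pi.mulSingle i (Equiv.swap a b) ∈ H := by
    intro i a b
    by_cases hab : a = b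
    · subst hab
      rw [Equiv.swap_self, ← Equiv.Perm.one_def, Pi.mulSingle_one]
      exact H.one_mem
    have hne : (r i a : L) ≠ r i b := fun h => hab ((r i).injective (Subtype.ext h))
    obtain ⟨σ, s1, s2, s3⟩ := hT i _ _ hne (hr0 i a) (hr0 i b)
    refine ⟨σ, fun j c => ?_⟩
    by_cases hj : j = i
    · subst hj
      rw [Pi.mulSingle_eq_same]
      by_cases hca : c = a
      · subst hca; rw [s1, Equiv.swap_apply_left]
      by_cases hcb : c = b
      · subst hcb; rw [s2, Equiv.swap_apply_right]
      rw [Equiv.swap_apply_of_ne_of_ne hca hcb]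
      exact s3 j _ (hr0 j c) (fun h => hca ((r j).injective (Subtype.ext h)))
        (fun h => hcb ((r j).injective (Subtype.ext h)))
    · rw [Pi.mulSingle_eq_of_ne hj]
      refine s3 j _ (hr0 j c) (fun h => ?_) (fun h => ?_)
      · exact hdis j i hj _ (hr0 j c) (h ▸ hr0 i a)
      · exact hdis j i hj _ (hr0 j c) (h ▸ hr0 i b)
  have hsingle : ∀ i (g : Equiv.Perm (Fin (N i))), Pi.mulSingle i g ∈ H := by
    intro i g
    induction g using Equiv.Perm.swap_induction_on with
    | one => rw [Pi.mulSingle_one]; exact H.one_mem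
    | swap_mul f x y _ ih =>
      rw [Pi.mulSingle_mul]
      exact H.mul_mem (hswap i x y) ih
  have hall : π ∈ H := Subgroup.pi_mem_of_mulSingle_mem π fun i => hsingle i _
  obtain ⟨σ, hσ⟩ := hall
  refine ⟨σ, hσ, ?_⟩
  intro σ' hσ'
  have hprod0 : ∏ j, P j ≠ 0 := Finset.prod_ne_zero_iff.2 fun j _ => h0 j
  have hext : (σ' : L →ₐ[K] L) = σ := by
    refine AlgHom.ext_of_adjoin_eq_top (IsSplittingField.adjoin_rootSet L (∏ j, P j)) ?_
    intro x hx
    have hx' := (mem_rootSet.1 hx).2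
    rw [map_prod, Finset.prod_eq_zero_iff] at hx'
    obtain ⟨j, _, hj⟩ := hx'
    have hxj : x ∈ (P j).rootSet L := mem_rootSet.2 ⟨h0 j, hj⟩
    have hre : ((r j ((r j).symm ⟨x, hxj⟩)) : L) = x := by rw [Equiv.apply_symm_apply]
    change σ' x = σ x
    rw [← hre, hσ, hσ']
  ext x
  exact DFunLike.congr_fun hext x

end Descend


section Main

theorem exists_base {k L : Type u} [Field k] [Field L] [Algebra k L] (N : ℕ)
    (a : Fin (N + 3 + 1) → L) (ha : AlgebraicIndependent k a) :
    ∃ (E : Type u) (_ : Field E) (_ : Algebra k E) (_ : Algebra E L) (_ : IsScalarTower k E L)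
      (b : Fin 2 → L) (q : E[X]), AlgebraicIndependent E b ∧
      (∑ j : Fin (N + 3 + 1), C (a j) * X ^ (j : ℕ)) =
        q.map (algebraMap E L) + (C (b 0) + C (b 1) * X) ∧
      ∀ Z : Subfield L, (∀ e, algebraMap E L e ∈ Z) → b 0 ∈ Z → b 1 ∈ Z →
        (∀ c, algebraMap k L c ∈ Z) ∧ ∀ j, a j ∈ Z := by
  let e2 : Fin 2 → Fin (N + 3 + 1) := Fin.castLE (by omega)
  have e2inj : Function.Injective e2 := Fin.castLE_injective _
  let s : Set (Fin (N + 3 + 1)) := {j | 2 ≤ (j : ℕ)}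
  let t : Set (Fin (N + 3 + 1)) := Set.range e2
  have hdisj : Disjoint s t := by
    rw [Set.disjoint_left]
    rintro _ hj ⟨l, rfl⟩
    have : 2 ≤ (l : ℕ) := hj
    omega
  let E := IntermediateField.adjoin k (a '' s)
  have h1 : AlgebraicIndependent E (fun i : t => a i) :=
    IntermediateField.algebraicIndependent_adjoin_iff.2 (ha.adjoin_of_disjoint hdisj)
  let b : Fin 2 → L := fun j => a (e2 j)
  have hb : AlgebraicIndependent E b :=
    h1.comp (fun j : Fin 2 => (⟨e2 j, j, rfl⟩ : t)) (fun x y h => e2inj (congrArg Subtype.val h))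
  have hmem : ∀ j : Fin (N + 1 + 1), a (j.natAdd 2 |>.cast (by omega)) ∈ E := by
    intro j
    refine IntermediateField.subset_adjoin k _ ⟨_, ?_, rfl⟩
    change 2 ≤ 2 + (j : ℕ)
    omega
  let q : E[X] := ∑ j : Fin (N + 1 + 1), C (⟨_, hmem j⟩ : E) * X ^ (2 + (j : ℕ))
  refine ⟨E, inferInstance, inferInstance, inferInstance, inferInstance, b, q, hb, ?_, ?_⟩
  · rw [Fin.sum_univ_succ, Fin.sum_univ_succ]
    have hq : q.map (algebraMap E L) = ∑ j : Fin (N + 1 + 1),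
        C (a (j.natAdd 2 |>.cast (by omega))) * X ^ (2 + (j : ℕ)) := by
      simp only [q, Polynomial.map_sum, Polynomial.map_mul, Polynomial.map_pow, Polynomial.map_X,
        Polynomial.map_C]
      rfl
    rw [hq, ← add_assoc, add_comm]
    have hs : ∀ j : Fin (N + 1 + 1), j.succ.succ = (j.natAdd 2 |>.cast (by omega) : Fin (N + 3 + 1)) := by
      intro j; ext; simp
    congr 1
    · refine Finset.sum_congr rfl fun j _ => ?_
      rw [hs]
      simp only [Fin.val_cast, Fin.val_natAdd]
    · simp [b, e2]
      rfl
  · intro Z hE hb0 hb1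
    refine ⟨fun c => ?_, fun j => ?_⟩
    · have := hE (algebraMap k E c)
      rwa [← IsScalarTower.algebraMap_apply] at this
    · by_cases hj : 2 ≤ (j : ℕ)
      · exact hE ⟨a j, IntermediateField.subset_adjoin k _ ⟨j, hj, rfl⟩⟩
      · by_cases h0 : (j : ℕ) = 0
        · have : j = e2 0 := Fin.ext h0
          rw [this]; exact hb0
        · have : j = e2 1 := Fin.ext (by change (j : ℕ) = 1; omega)
          rw [this]; exact hb1

theorem glue_abstract {R K L ι Ω Λ M : Type*} [CommRing R] [Field K] [Algebra R K]
    [IsFractionRing R K] [Field L] [Algebra K L] [Fintype ι] [Field Ω] [IsAlgClosed Ω]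
    [Field Λ] [Field M] [Algebra (PowerSeries Ω) Λ] [IsFractionRing (PowerSeries Ω) Λ]
    [Algebra Λ M] [IsAlgClosed M] [Normal Λ M]
    (φ : R →+* PowerSeries Ω) (hφ : Function.Injective φ) (Q : ι → R[X]) (P : ι → K[X])
    (hP : ∀ j, P j = (Q j).map (algebraMap R K)) (hP0 : ∀ j, P j ≠ 0)
    [hL : IsSplittingField K L (∏ j, P j)] (t₀ : Ω) (i : ι) (hsep : (P i).Separable)
    (s1 : ∀ j, IsUnit ((Q j).map φ).leadingCoeff)
    (s2 : ∀ j a, a ≠ t₀ → (((Q j).map φ).map PowerSeries.constantCoeff).eval a = 0 →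
      (derivative (((Q j).map φ).map PowerSeries.constantCoeff)).eval a ≠ 0)
    (s3 : ∀ j, j ≠ i → (((Q j).map φ).map PowerSeries.constantCoeff).eval t₀ ≠ 0)
    (s4 : (((Q i).map φ).map PowerSeries.constantCoeff).eval t₀ = 0)
    (s5 : (((Q i).map φ).map PowerSeries.constantCoeff).rootMultiplicity t₀ ≤ 2)
    (s6 : ∀ θ, ((Q i).map φ).eval θ = 0 → PowerSeries.constantCoeff θ ≠ t₀) :
    ∃ (σ : L ≃ₐ[K] L) (β γ : L), β ≠ γ ∧ aeval β (P i) = 0 ∧ aeval γ (P i) = 0 ∧ σ β = γ ∧ σ γ = β ∧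
      ∀ j θ, aeval θ (P j) = 0 → θ ≠ β → θ ≠ γ → σ θ = θ := by
  have hinj : Function.Injective ((algebraMap (PowerSeries Ω) Λ).comp φ) :=
    (IsFractionRing.injective (PowerSeries Ω) Λ).comp hφ
  let g : K →+* Λ := IsFractionRing.lift hinj
  have hg : g.comp (algebraMap R K) = (algebraMap (PowerSeries Ω) Λ).comp φ := by
    ext x
    exact IsFractionRing.lift_algebraMap hinj x
  let _ : Algebra K Λ := g.toAlgebra
  let _ : Algebra K M := ((algebraMap Λ M).comp g).toAlgebra
  have : IsScalarTower K Λ M := IsScalarTower.of_algebraMap_eq fun _ => rfl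
  have hPΛ : ∀ j, (P j).map g = ((Q j).map φ).map (algebraMap (PowerSeries Ω) Λ) := by
    intro j
    rw [hP, Polynomial.map_map, Polynomial.map_map, hg]
  have haev : ∀ j (θ : M), aeval θ (P j) =
      ((((Q j).map φ).map (algebraMap (PowerSeries Ω) Λ)).map (algebraMap Λ M)).eval θ := by
    intro j θ
    rw [← hPΛ, Polynomial.map_map, ← eval_map_algebraMap]
    rfl
  obtain ⟨σ, β, γ, hne, hβ, hγ, h1, h2, h3⟩ := exists_transposition (Λ := Λ) (M := M)
    (fun j => (Q j).map φ) s1 t₀ i s2 s3 s4 s5 s6 (by rw [← hPΛ]; exact hsep.map)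
  simp only [← haev] at hβ hγ h3
  exact descend_transposition P hP0 i σ β γ hne hβ hγ h1 h2 h3

/-- The abstract version of the theorem. -/
theorem main_abstract {k K L : Type u} [Field k] [IsAlgClosed k] (N m : ℕ)
    [Field K] [Algebra (MvPolynomial (Fin (N + 3 + 1)) k) K]
    [IsFractionRing (MvPolynomial (Fin (N + 3 + 1)) k) K] [Field L] [Algebra K L]
    (F : Fin m → k[X][X]) (hmon : ∀ j, (F j).Monic) (hirr : ∀ j, Irreducible (F j))
    (hdeg : ∀ j, 0 < (F j).natDegree)
    (hF : ∀ i, ∀ j ≤ (F i).natDegree,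
      ((F i).coeff j).natDegree ≤ ((F i).natDegree - j) * (N + 3))
    (hsep : ((∏ j, F j).map (algebraMap k[X] (FractionRing k[X]))).Separable)
    (f : Polynomial (MvPolynomial (Fin (N + 3 + 1)) k))
    (hf : f = ∑ j : Fin (N + 3 + 1), C (MvPolynomial.X j) * X ^ (j : ℕ))
    (P : Fin m → K[X])
    (hP : ∀ j, P j = (ev2 (F j) X f).map (algebraMap (MvPolynomial (Fin (N + 3 + 1)) k) K))
    [hL : IsSplittingField K L (∏ j, P j)] :
    (∀ i, Nat.card ((P i).rootSet L) = (F i).natDegree * (N + 3)) ∧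
    ∀ r : (∀ i, Fin ((F i).natDegree * (N + 3)) ≃ (P i).rootSet L),
      ∀ π : (∀ i, Equiv.Perm (Fin ((F i).natDegree * (N + 3)))),
        ∃! σ : L ≃ₐ[K] L, ∀ i a, σ (r i a : L) = (r i (π i a) : L) := by
  classical
  let R := MvPolynomial (Fin (N + 3 + 1)) k
  let _ : Algebra R L := ((algebraMap K L).comp (algebraMap R K)).toAlgebra
  have : IsScalarTower R K L := IsScalarTower.of_algebraMap_eq fun _ => rfl
  let _ : Algebra k K := ((algebraMap R K).comp (algebraMap k R)).toAlgebra
  let _ : Algebra k L := ((algebraMap K L).comp (algebraMap k K)).toAlgebra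
  have : IsScalarTower k R K := IsScalarTower.of_algebraMap_eq fun _ => rfl
  have : IsScalarTower k K L := IsScalarTower.of_algebraMap_eq fun _ => rfl
  have : IsScalarTower k R L := IsScalarTower.of_algebraMap_eq fun _ => rfl
  have hRK : Function.Injective (algebraMap R K) := IsFractionRing.injective R K
  have hRL : Function.Injective (algebraMap R L) := (algebraMap K L).injective.comp hRK
  let a : Fin (N + 3 + 1) → L := fun j => algebraMap R L (MvPolynomial.X j)
  have ha : AlgebraicIndependent k a :=
    (MvPolynomial.algebraicIndependent_X (Fin (N + 3 + 1)) k).map'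
      (f := IsScalarTower.toAlgHom k R L) hRL
  obtain ⟨E, _, _, _, _, b, q, hb, hq, hgen⟩ := exists_base N a ha
  have hfL : f.map (algebraMap R L) = q.map (algebraMap E L) + (C (b 0) + C (b 1) * X) := by
    rw [← hq, hf]
    simp [a, Polynomial.map_sum]
  set fL := f.map (algebraMap R L) with hfLdef
  have hev : ∀ G : k[X][X], (ev2 G X f).map (algebraMap R L) = ev2 G X fL := fun G =>
    mapPoly_ev2 (IsScalarTower.toAlgHom k R L) G f
  have hPL : ∀ j, (P j).map (algebraMap K L) = ev2 (F j) X fL := by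
    intro j
    rw [hP, Polynomial.map_map, ← IsScalarTower.algebraMap_eq, hev]
  have haev : ∀ j (x : L), aeval x (P j) = (ev2 (F j) X fL).eval x := by
    intro j x
    rw [← hPL, eval_map_algebraMap]
  -- degrees
  have hfdeg : f.natDegree ≤ N + 3 := by
    rw [hf]
    refine natDegree_sum_le_of_forall_le _ _ fun j _ => ?_
    exact (natDegree_C_mul_X_pow_le _ _).trans (by omega)
  have hftop : f.coeff (N + 3) = MvPolynomial.X (Fin.last (N + 3)) := by
    rw [hf, finsetSum_coeff, Finset.sum_eq_single (Fin.last (N + 3))]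
    · simp
    · intro j _ hj
      have : N + 3 ≠ j := fun h => hj (Fin.ext h.symm)
      simp [coeff_X_pow, this]
    · simp
  have hPdeg : ∀ j, (P j).natDegree = (F j).natDegree * (N + 3) := by
    intro j
    rw [hP, natDegree_map_eq_of_injective hRK]
    refine natDegree_ev2_eq (F j) (hmon j) (N + 3) f hfdeg (hF j) ?_
    rw [hftop]
    exact MvPolynomial.transcendental_X k _
  have hP0 : ∀ j, P j ≠ 0 := by
    intro j h
    have := hPdeg j
    rw [h, natDegree_zero] at this
    have := hdeg j
    have : 0 < (F j).natDegree * (N + 3) := by positivity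
    omega
  have hprod0 : ∏ j, P j ≠ 0 := Finset.prod_ne_zero_iff.2 fun j _ => hP0 j
  -- separability
  have hmonprod : (∏ j, F j).Monic := monic_prod_of_monic _ _ fun j _ => hmon j
  have hprodL : (∏ j, P j).map (algebraMap K L) = ev2 (∏ j, F j) X fL := by
    rw [Polynomial.map_prod, ev2_prod]
    exact Finset.prod_congr rfl fun j _ => hPL j
  have hsimple : ∀ x : L, ((∏ j, P j).map (algebraMap K L)).eval x = 0 →
      (derivative ((∏ j, P j).map (algebraMap K L))).eval x ≠ 0 := by
    intro x hx
    rw [hprodL] at hx ⊢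
    refine simple_roots (∏ j, F j) hmonprod hsep hb q 1 fL ?_ x ?_ hx
    · rw [hfL]; simp
    · simp
  have hPsep : (∏ j, P j).Separable := by
    rw [← separable_map (algebraMap K L)]
    have hne : (∏ j, P j).map (algebraMap K L) ≠ 0 :=
      (Polynomial.map_ne_zero_iff (algebraMap K L).injective).2 hprod0
    rw [← nodup_roots_iff_of_splits hne (IsSplittingField.splits L _),
      Multiset.nodup_iff_count_le_one]
    intro x
    rw [count_roots]
    by_contra hlt
    have h2 := (one_lt_rootMultiplicity_iff_isRoot hne).1 (not_le.1 hlt)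
    exact hsimple x h2.1 h2.2
  have hPisep : ∀ i, (P i).Separable := fun i =>
    hPsep.of_dvd (Finset.dvd_prod_of_mem P (Finset.mem_univ i))
  have hnorm : Normal K L := Normal.of_isSplittingField (∏ j, P j)
  have hsplit : ∀ j, ((P j).map (algebraMap K L)).Splits := by
    intro j
    refine (IsSplittingField.splits L (∏ j, P j)).of_dvd ?_ ?_
    · exact (Polynomial.map_ne_zero_iff (algebraMap K L).injective).2 hprod0
    · exact Polynomial.map_dvd _ (Finset.dvd_prod_of_mem P (Finset.mem_univ j))
  have hdis : ∀ i j, i ≠ j → ∀ x : L, aeval x (P i) = 0 → aeval x (P j) ≠ 0 := by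
    intro i j hij x hi hj
    refine hsimple x ?_ ?_
    · rw [eval_map_algebraMap, map_prod]
      exact Finset.prod_eq_zero (Finset.mem_univ i) hi
    · have hji : j ∈ Finset.univ.erase i := Finset.mem_erase.2 ⟨hij.symm, Finset.mem_univ j⟩
      rw [derivative_map, eval_map_algebraMap, ← Finset.mul_prod_erase _ _ (Finset.mem_univ i),
        derivative_mul, map_add, map_mul, map_mul, hi, map_prod, Finset.prod_eq_zero hji hj]
      simp
  refine ⟨?_, ?_⟩
  · intro i
    rw [Nat.card_eq_fintype_card, card_rootSet_eq_natDegree (hPisep i) (hsplit i), hPdeg]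
  intro r π
  refine realize_all P _ hP0 hdis ?_ r π
  intro i
  refine all_transpositions P i ?_ ?_
  · -- a transposition
    obtain ⟨Ω, _, _, _, φ, t₀, hφ, hspec⟩ := exists_special N F hmon hF hsep i (hdeg i) f hf
    obtain ⟨s1, s2, s3, s4, s5, s6⟩ := hspec
      (fun j => ev2 (F j) X (f.map (φ : R →+* PowerSeries Ω))) (fun j => rfl)
    have e : ∀ j, ev2 (F j) X (f.map (φ : R →+* PowerSeries Ω)) =
        (ev2 (F j) X f).map (φ : R →+* PowerSeries Ω) := fun j => (mapPoly_ev2 φ (F j) f).symm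
    simp only [e] at s1 s2 s3 s4 s5 s6
    exact glue_abstract (Λ := FractionRing (PowerSeries Ω))
      (M := AlgebraicClosure (FractionRing (PowerSeries Ω))) (φ : R →+* PowerSeries Ω) hφ
      (fun j => ev2 (F j) X f) P hP hP0 t₀ i (hPisep i) s1 s2 s3 s4 s5 s6
  · -- two-transitivity
    intro β γ β' γ' hne hne' hβ hγ hβ' hγ'
    rw [haev] at hβ hγ hβ' hγ'
    refine exists_algEquiv_pair (F i) (hmon i) (hirr i) hb q fL hfL ?_ hne hne' hβ hγ hβ' hγ'
    intro Z hE hb0 hb1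
    obtain ⟨hc, haj⟩ := hgen Z hE hb0 hb1
    have hR : ∀ z : R, algebraMap R L z ∈ Z := by
      intro z
      induction z using MvPolynomial.induction_on with
      | C c => exact hc c
      | add p q hp hq => rw [map_add]; exact add_mem hp hq
      | mul_X p j hp => rw [map_mul]; exact mul_mem hp (haj j)
    intro z
    obtain ⟨x, y, _, rfl⟩ := IsFractionRing.div_surjective (A := R) z
    rw [map_div₀, ← IsScalarTower.algebraMap_apply, ← IsScalarTower.algebraMap_apply]
    exact div_mem (hR x) (hR y)

end Main


theorem substF_eq_ev2 {K : Type} [CommRing K] (n : ℕ) (F : Polynomial (Polynomial K)) :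
    substF n F = ev2 F X (fsharp K n) := by
  rw [substF, ev2, eval_map]
  congr 1

theorem coeff_natDegree_le_of_slopeX {K : Type} [Field K] (n : ℕ) (F : Polynomial (Polynomial K))
    (hmon : F.Monic) (h : slopeX F ≤ ((n : ℚ) : WithBot ℚ)) (j : ℕ) (hj : j ≤ F.natDegree) :
    (F.coeff j).natDegree ≤ (F.natDegree - j) * n := by
  rcases hj.eq_or_lt with rfl | hlt
  · simp [hmon.coeff_natDegree]
  · rw [slopeX, Finset.sup_le_iff] at h
    have h1 := h (F.natDegree - j) (by rw [Finset.mem_Icc]; omega)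
    rw [Nat.sub_sub_self hj] at h1
    by_cases h0 : F.coeff j = 0
    · simp [h0]
    · rw [degree_eq_natDegree h0] at h1
      have h2 : (((F.coeff j).natDegree : ℚ) / ((F.natDegree - j : ℕ) : ℚ)) ≤ (n : ℚ) :=
        WithBot.coe_le_coe.1 h1
      have hpos : (0 : ℚ) < ((F.natDegree - j : ℕ) : ℚ) := by
        exact_mod_cast Nat.sub_pos_of_lt hlt
      rw [div_le_iff₀ hpos] at h2
      have h3 : (F.coeff j).natDegree ≤ n * (F.natDegree - j) := by exact_mod_cast h2
      rwa [mul_comm] at h3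

theorem generic_substitution_aux {k : Type} [Field k] [IsAlgClosed k]
    (p : ℕ) [Fact (Nat.Prime p)] [CharP k p] (m N : ℕ)
    (F : Fin m → Polynomial (Polynomial k))
    (hdegx : ∀ i, 0 < (F i).natDegree)
    (hnonassoc : ∀ i j, i ≠ j → ¬ Associated (F i) (F j))
    (hirr : ∀ i, Irreducible (F i))
    (hmonic : ∀ i, (F i).Monic)
    (hsep : ∀ i, ∀ G : Polynomial (Polynomial k), F i ≠ G.comp (Polynomial.X ^ p))
    (hslope : ∀ i, slopeX (F i) ≤ (((N + 3 : ℕ) : ℚ) : WithBot ℚ)) :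
    let R := MvPolynomial (Fin (N + 3 + 1)) k
    let Ka := FractionRing R
    let Pprod : Polynomial Ka := (substF (N + 3) (∏ i, F i)).map (algebraMap R Ka)
    let L := Pprod.SplittingField
    let Pi : Fin m → Polynomial Ka := fun i => (substF (N + 3) (F i)).map (algebraMap R Ka)
    (∀ i, Nat.card ((Pi i).rootSet L) = (F i).natDegree * (N + 3)) ∧
    ∀ r : (∀ i, Fin ((F i).natDegree * (N + 3)) ≃ (Pi i).rootSet L),
      ∀ π : (∀ i, Equiv.Perm (Fin ((F i).natDegree * (N + 3)))),
        ∃! σ : L ≃ₐ[Ka] L, ∀ i a, σ (r i a : L) = (r i (π i a) : L) := by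
  intro R Ka Pprod L Pi
  have hprod : Pprod = ∏ j, Pi j := by
    simp only [Pprod, Pi, substF_eq_ev2, ev2_prod, Polynomial.map_prod]
  have hL : IsSplittingField Ka L (∏ j, Pi j) := by
    rw [← hprod]
    exact Polynomial.IsSplittingField.splittingField Pprod
  refine main_abstract N m F hmonic hirr hdegx
    (fun i j hj => coeff_natDegree_le_of_slopeX (N + 3) (F i) (hmonic i) (hslope i) j hj) ?_
    (fsharp k (N + 3)) rfl Pi (fun j => by simp only [Pi, substF_eq_ev2]; rfl)
  rw [Polynomial.map_prod]
  refine separable_prod (fun i j hij => ?_) fun i => ?_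
  · exact isCoprime_map_of_irreducible _ _ (hmonic i) (hmonic j) (hirr i) (hirr j)
      (hnonassoc i j hij)
  · exact separable_map_of_irreducible p _ (hmonic i) (hirr i) (hsep i)

/-- for `p > 2`, `k = F̄_p`, and pairwise non-associate irreducible
`F_i ∈ k[t][x]` monic in `x`, separable over `k(t)`, `deg_x F_i = r_i > 0`, and
`n ≥ 3` with `n ≥ sl F_i`, the Galois group of the splitting field `L` of
`∏ F_i(t,f♯)` over `k(a_0,…,a_n)` is the full product `S_{N_1} × … × S_{N_m}`
(`N_i = r_i n`) acting on the roots of the `F_i(t,f♯)`: each `F_i(t,f♯)` has exactly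
`N_i` roots in `L`, and for any enumerations `r_i` of the root sets and any tuple of
permutations `π_i ∈ S_{N_i}`, there is exactly one `σ ∈ Gal(L/k(a_0,…,a_n))`
inducing the `π_i` on the roots. -/
theorem galois_group_of_generic_substitution_eq_full_product
    (p : ℕ) [Fact (Nat.Prime p)] (hp : 2 < p) (m : ℕ) (hm : 1 ≤ m) (n : ℕ) (hn : 3 ≤ n)
    (F : Fin m → Polynomial (Polynomial (AlgebraicClosure (ZMod p))))
    (hdegx : ∀ i, 0 < (F i).natDegree)
    (hnonassoc : ∀ i j, i ≠ j → ¬ Associated (F i) (F j))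
    (hirr : ∀ i, Irreducible (F i))
    (hmonic : ∀ i, (F i).Monic)
    (hsep : ∀ i, ∀ G : Polynomial (Polynomial (AlgebraicClosure (ZMod p))),
      F i ≠ G.comp (Polynomial.X ^ p))
    (hslope : ∀ i, slopeX (F i) ≤ ((n : ℚ) : WithBot ℚ)) :
    let k := AlgebraicClosure (ZMod p)
    let R := MvPolynomial (Fin (n + 1)) k
    let Ka := FractionRing R
    let Pprod : Polynomial Ka := (substF n (∏ i, F i)).map (algebraMap R Ka)
    let L := Pprod.SplittingField
    let Pi : Fin m → Polynomial Ka := fun i => (substF n (F i)).map (algebraMap R Ka)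
    let N : Fin m → ℕ := fun i => (F i).natDegree * n
    (∀ i, Nat.card ((Pi i).rootSet L) = N i) ∧
    ∀ r : (∀ i, Fin (N i) ≃ (Pi i).rootSet L),
      ∀ π : (∀ i, Equiv.Perm (Fin (N i))),
        ∃! σ : L ≃ₐ[Ka] L, ∀ i a, σ (r i a : L) = (r i (π i a) : L) := by
  obtain ⟨N, rfl⟩ : ∃ N, n = N + 3 := ⟨n - 3, by omega⟩
  exact generic_substitution_aux p m N F hdegx hnonassoc hirr hmonic hsep hslope
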